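/- arXiv:0811.1399 — 3 statements merged into one kernel-verified Lean document; each statement's English description precedes it below -/
import Mathlib

section
/- The quadratic polynomial ζ_1 is a singular (highest-weight) vector of weight λ_6: e_i(ζ_1) = 0 for every i = 1,…,6, and the operators h_j := e_j∘f_j − f_j∘e_j satisfy h_j(ζ_1) = 0 for j = 1,…,5 and h_6(ζ_1) = −ζ_1. -/
open MvPolynomial
open scoped Fin.NatCast

noncomputable section

abbrev A : Type := MvPolynomial (Fin 27) ℂ

/-- the variable `x_i` (1-based indexing). -/
def xv (i : ℕ) : A := X ((i - 1 : ℕ) : Fin 27)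

/-- the partial derivative `∂_i` (1-based indexing) as a linear operator. -/
def pdE (i : Fin 27) : Module.End ℂ A := (pderiv i).toLinearMap

/-- the operator `x_a ∂_b` (1-based indexing). -/
def md (a b : ℕ) : Module.End ℂ A :=
  (LinearMap.mulLeft ℂ (xv a)) ∘ₗ pdE ((b - 1 : ℕ) : Fin 27)

/-- the actions `e_1, …, e_6` of the simple positive root vectors of `E₆`. -/
def eOp : ℕ → Module.End ℂ A
  | 1 => -md 1 2 + md 11 14 + md 15 17 + md 16 19 + md 18 21 + md 20 23
  | 2 => -md 4 6 - md 5 7 - md 8 10 + md 18 20 + md 21 23 + md 22 24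
  | 3 => -md 2 3 + md 9 11 + md 12 15 + md 13 16 + md 21 22 + md 23 24
  | 4 => -md 3 4 - md 7 9 - md 10 12 - md 16 18 - md 19 21 + md 24 25
  | 5 => -md 4 5 - md 6 7 - md 12 13 - md 15 16 - md 17 19 + md 25 26
  | 6 => -md 5 8 - md 7 10 - md 9 12 - md 11 15 - md 14 17 + md 26 27
  | _ => 0

/-- the actions `f_1, …, f_6` of the simple negative root vectors of `E₆`. -/
def fOp : ℕ → Module.End ℂ A
  | 1 => md 2 1 - md 14 11 - md 17 15 - md 19 16 - md 21 18 - md 23 20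
  | 2 => md 6 4 + md 7 5 + md 10 8 - md 20 18 - md 23 21 - md 24 22
  | 3 => md 3 2 - md 11 9 - md 15 12 - md 16 13 - md 22 21 - md 24 23
  | 4 => md 4 3 + md 9 7 + md 12 10 + md 18 16 + md 21 19 - md 25 24
  | 5 => md 5 4 + md 7 6 + md 13 12 + md 16 15 + md 19 17 - md 26 25
  | 6 => md 8 5 + md 10 7 + md 12 9 + md 15 11 + md 17 14 - md 27 26
  | _ => 0

/-- the involution of `{0,…,26}` fixing `12, 13, 14` (0-based version of ι). -/
def iotaF : Fin 27 → Fin 27 := fun j =>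
  if j.val = 12 ∨ j.val = 13 ∨ j.val = 14 then j else ⟨26 - j.val, by omega⟩

/-- the algebra automorphism τ of `A`. -/
def tau : A →ₐ[ℂ] A := rename iotaF

def z1 : A := xv 1 * xv 14 + xv 2 * xv 11 + xv 3 * xv 9 - xv 4 * xv 7 + xv 5 * xv 6
def z2 : A := fOp 6 z1
def z3 : A := fOp 5 z2
def z4 : A := fOp 4 z3
def z5 : A := fOp 3 z4
def z6 : A := fOp 2 z4
def z7 : A := fOp 3 z6
def z8 : A := fOp 1 z5
def z9 : A := fOp 4 z7
def z10 : A := fOp 1 z7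
def z11 : A := -(fOp 5 z9)
def z12 : A := fOp 4 z10
def z13 : A := fOp 3 z12
def z14 : A := -(fOp 6 z11)
def z15 : A := -(fOp 5 z12)

/-- the quadratic polynomials `ζ_1, …, ζ_27` (1-based indexing). -/
def zeta : ℕ → A
  | 1 => z1 | 2 => z2 | 3 => z3 | 4 => z4 | 5 => z5 | 6 => z6 | 7 => z7
  | 8 => z8 | 9 => z9 | 10 => z10 | 11 => z11 | 12 => z12 | 13 => z13
  | 14 => z14 | 15 => z15
  | 16 => tau z12 | 17 => tau z11 | 18 => tau z10 | 19 => tau z9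
  | 20 => tau z8 | 21 => tau z7 | 22 => tau z6 | 23 => tau z5
  | 24 => tau z4 | 25 => tau z3 | 26 => tau z2 | 27 => tau z1
  | _ => 0

/-- the involution ι of `{1,…,27}` fixing `13, 14, 15`. -/
def iotaN (i : ℕ) : ℕ := if i = 13 ∨ i = 14 ∨ i = 15 then i else 28 - i

/-- the signs ε_i. -/
def eps (i : ℕ) : ℂ :=
  if i = 9 ∨ i = 11 ∨ i = 12 ∨ i = 13 ∨ i = 14 ∨ i = 15 ∨ i = 16 ∨ i = 17 ∨ i = 19
  then -1 else 1

/-- the `E₆`-invariant cubic polynomial η (Dickson's trilinear form). -/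
def eta : A := ∑ i ∈ Finset.Icc 1 27, eps i • (xv i * zeta (iotaN i))

lemma pderiv_swap (i j : Fin 27) (p : A) :
    pderiv i (pderiv j p) = pderiv j (pderiv i p) := by
  induction p using MvPolynomial.induction_on with
  | C a => simp
  | add p q hp hq => simp [hp, hq]
  | mul_X p k ih =>
      have h1 : pderiv i ((pderiv j) (X k) : A) = 0 := by
        rcases eq_or_ne j k with h | h
        · subst h; simp [pderiv_X_self]
        · simp [pderiv_X_of_ne (Ne.symm h)]
      have h2 : pderiv j ((pderiv i) (X k) : A) = 0 := by
        rcases eq_or_ne i k with h | h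
        · subst h; simp [pderiv_X_self]
        · simp [pderiv_X_of_ne (Ne.symm h)]
      simp only [pderiv_mul, map_add, ih, h1, h2]
      ring

lemma pdE_comm (i j : Fin 27) : Commute (pdE i) (pdE j) := by
  refine LinearMap.ext fun p => ?_
  simpa [pdE, Module.End.mul_apply] using pderiv_swap i j p

/-- `Im(g)`: the constant-coefficient differential operator obtained from `g` by
replacing each variable `x_i` by `∂_i`. -/
def Imo (g : A) : Module.End ℂ A :=
  ∑ d ∈ g.support, g.coeff d •
    Finset.univ.noncommProd (fun i : Fin 27 => pdE i ^ d i)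
      (fun i _ j _ _ => (pdE_comm i j).pow_pow _ _)

/-- the invariant operator `D = Im(η)`. -/
def Dop : Module.End ℂ A := Imo eta

/-- the Euler operator `D₁`. -/
def D1 : Module.End ℂ A := ∑ i : Fin 27, (LinearMap.mulLeft ℂ (X i : A)) ∘ₗ pdE i

/-- the invariant operator `D₂ = Σ ζ_i · Im(ζ_i)`. -/
def D2 : Module.End ℂ A :=
  ∑ i ∈ Finset.Icc 1 27, (LinearMap.mulLeft ℂ (zeta i)) ∘ₗ Imo (zeta i)


lemma md_mul (a b : ℕ) (p q : A) : md a b (p * q) = p * md a b q + q * md a b p := by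
  simp only [md, pdE, LinearMap.comp_apply, Derivation.coeFn_coe, LinearMap.mulLeft_apply,
    Derivation.leibniz, smul_eq_mul]
  ring

lemma md_xv (a b c : ℕ) :
    md a b (xv c) = if ((c - 1 : ℕ) : Fin 27) = ((b - 1 : ℕ) : Fin 27) then xv a else 0 := by
  simp only [md, pdE, xv, LinearMap.comp_apply, Derivation.coeFn_coe, LinearMap.mulLeft_apply,
    pderiv_X, Pi.single_apply, mul_ite, mul_one, mul_zero, eq_comm]

/-- ζ₁ is a singular vector of weight λ₆. -/
theorem stmt0 :
    (∀ i : ℕ, 1 ≤ i → i ≤ 6 → eOp i (zeta 1) = 0) ∧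
    (∀ j : ℕ, 1 ≤ j → j ≤ 5 →
      eOp j (fOp j (zeta 1)) - fOp j (eOp j (zeta 1)) = 0) ∧
    eOp 6 (fOp 6 (zeta 1)) - fOp 6 (eOp 6 (zeta 1)) = -zeta 1 := by
  have he : ∀ i : ℕ, 1 ≤ i → i ≤ 6 → eOp i (zeta 1) = 0 := by
    intro i hi hi'
    interval_cases i <;>
      simp [eOp, zeta, z1, md_mul, md_xv, Fin.ext_iff] <;> ring
  refine ⟨he, fun j hj hj' => ?_, ?_⟩
  · rw [he j hj (by omega), map_zero, sub_zero]
    interval_cases j <;>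
      simp [eOp, fOp, zeta, z1, md_mul, md_xv, Fin.ext_iff]
  · rw [he 6 (by omega) le_rfl, map_zero, sub_zero]
    simp [eOp, fOp, zeta, z1, md_mul, md_xv, Fin.ext_iff]
    ring

end
end

section
/- D_2(x_1^{m_1}·ζ_1^{m_2}) = m_2(m_1 + m_2 + 4)·x_1^{m_1}·ζ_1^{m_2} for all nonnegative integers m_1, m_2. -/
open MvPolynomial
open scoped Fin.NatCast

noncomputable section

lemma pdE_pow_pairwise_commute (d : Fin 27 →₀ ℕ) :
    ((Finset.univ : Finset (Fin 27)) : Set (Fin 27)).Pairwise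
      (Function.onFun Commute fun i => pdE i ^ d i) :=
  fun i _ j _ _ => (pdE_comm i j).pow_pow _ _

/-- The operator `∂^d` attached to an exponent vector `d`. -/
def monomialOp (d : Fin 27 →₀ ℕ) : Module.End ℂ A :=
  Finset.univ.noncommProd (fun i : Fin 27 => pdE i ^ d i) (pdE_pow_pairwise_commute d)

lemma monomialOp_add (d e : Fin 27 →₀ ℕ) :
    monomialOp (d + e) = monomialOp d * monomialOp e := by
  unfold monomialOp
  rw [← Finset.noncommProd_mul_distrib (fun i : Fin 27 => pdE i ^ d i) (fun i => pdE i ^ e i)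
    (pdE_pow_pairwise_commute d) (pdE_pow_pairwise_commute e) (fun i _ j _ _ => (pdE_comm i j).pow_pow _ _)]
  exact Finset.noncommProd_congr rfl (fun i _ => by simp [pow_add]) _

lemma monomialOp_single (a : Fin 27) : monomialOp (Finsupp.single a 1) = pdE a := by
  have h (comm) : (Finset.univ.erase a).noncommProd
      (fun i => pdE i ^ Finsupp.single a 1 i) comm = 1 := by
    rw [Finset.noncommProd_eq_pow_card _ _ _ 1, one_pow]
    intro x hx
    simp [(Finset.ne_of_mem_erase hx).symm]
  refine (Finset.noncommProd_erase_mul Finset.univ (Finset.mem_univ a) _ _).symm.trans ?_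
  refine (congrArg (· * _) (h _)).trans ?_
  simp

lemma monomialOp_apply_eq_zero {d : Fin 27 →₀ ℕ} {j : Fin 27} (hd : d j ≠ 0) {v : A}
    (hv : pdE j v = 0) : monomialOp d v = 0 := by
  unfold monomialOp
  rw [← Finset.noncommProd_erase_mul Finset.univ (Finset.mem_univ j), Module.End.mul_apply]
  obtain ⟨k, hk⟩ := Nat.exists_eq_succ_of_ne_zero hd
  simp [hk, pow_succ, hv]

lemma Imo_eq_linearCombination (g : A) :
    Imo g = Finsupp.linearCombination ℂ monomialOp (AddMonoidAlgebra.coeff g) := rfl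

lemma Imo_add (g h : A) : Imo (g + h) = Imo g + Imo h := by
  simp [Imo_eq_linearCombination]

lemma Imo_neg (g : A) : Imo (-g) = -Imo g := by
  simp [Imo_eq_linearCombination]

lemma Imo_sub (g h : A) : Imo (g - h) = Imo g - Imo h := by
  rw [sub_eq_add_neg, Imo_add, Imo_neg, sub_eq_add_neg]

lemma Imo_monomial (d : Fin 27 →₀ ℕ) : Imo (monomial d 1) = monomialOp d := by
  simp [Imo, support_monomial, monomialOp]

lemma Imo_X_mul_X (a b : Fin 27) : Imo (X a * X b) = pdE a * pdE b := by
  rw [X, X, monomial_mul, one_mul, Imo_monomial, monomialOp_add, monomialOp_single,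
    monomialOp_single]

lemma Imo_apply_eq_zero {g v : A}
    (h : ∀ d ∈ g.support, ∃ j, d j ≠ 0 ∧ pdE j v = 0) : Imo g v = 0 := by
  rw [Imo, LinearMap.sum_apply]
  refine Finset.sum_eq_zero fun d hd => ?_
  obtain ⟨j, hj, hv⟩ := h d hd
  rw [LinearMap.smul_apply]
  exact (congrArg _ (monomialOp_apply_eq_zero hj hv)).trans (smul_zero _)

/-- The grading of the variables by the coefficient of the sixth simple root; the weight-zero
variables are those occurring in `ζ₁`. -/
def wt (j : Fin 27) : ℤ :=
  if j.val = 26 then 2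
  else if j.val = 7 ∨ j.val = 9 ∨ j.val = 11 ∨ j.val = 12 ∨ 14 ≤ j.val then 1 else 0

/-- The grading obtained from `wt` by the involution `iotaF`. -/
def wtDual (j : Fin 27) : ℤ := wt (iotaF j)

lemma iotaF_injective : Function.Injective iotaF := by decide

lemma exists_weight_ne_zero {w : Fin 27 → ℤ} {g : A} {n : ℤ} (hg : IsWeightedHomogeneous w g n)
    (hn : n ≠ 0) {d : Fin 27 →₀ ℕ} (hd : d ∈ g.support) : ∃ j, d j ≠ 0 ∧ w j ≠ 0 := by
  by_contra! h
  refine hn ?_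
  rw [← hg (mem_support_iff.mp hd), Finsupp.weight_apply]
  exact Finset.sum_eq_zero fun j hj => by simp [h j (Finsupp.mem_support_iff.mp hj)]

lemma Imo_apply_eq_zero_of_weight {g v : A} {n : ℤ} (hv : ∀ j, wt j ≠ 0 → pdE j v = 0)
    (hg : IsWeightedHomogeneous wt g n) (hn : n ≠ 0) : Imo g v = 0 :=
  Imo_apply_eq_zero fun _ hd =>
    let ⟨j, hj, hw⟩ := exists_weight_ne_zero hg hn hd
    ⟨j, hj, hv j hw⟩

lemma Imo_tau_apply_eq_zero {g v : A} {n : ℤ} (hv : ∀ j, wt j ≠ 0 → pdE j v = 0)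
    (hg : IsWeightedHomogeneous wtDual g n) (hn : n ≠ 0) : Imo (tau g) v = 0 := by
  refine Imo_apply_eq_zero fun d hd => ?_
  obtain ⟨e, rfl, he⟩ := coeff_rename_ne_zero _ _ _ (mem_support_iff.mp hd)
  obtain ⟨j, hj, hw⟩ := exists_weight_ne_zero hg hn (mem_support_iff.mpr he)
  exact ⟨iotaF j, by rwa [Finsupp.mapDomain_apply iotaF_injective], hv _ hw⟩

lemma md_isWeightedHomogeneous {w : Fin 27 → ℤ} {g : A} {n c : ℤ} (a b : ℕ)
    (hg : IsWeightedHomogeneous w g n)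
    (h : w ((a - 1 : ℕ) : Fin 27) - w ((b - 1 : ℕ) : Fin 27) = c) :
    IsWeightedHomogeneous w (md a b g) (n + c) := by
  have h1 : IsWeightedHomogeneous w (pderiv ((b - 1 : ℕ) : Fin 27) g)
      (n - w ((b - 1 : ℕ) : Fin 27)) := hg.pderiv (sub_add_cancel _ _)
  have h2 := (isWeightedHomogeneous_X ℂ w ((a - 1 : ℕ) : Fin 27)).mul h1
  rwa [show w ((a - 1 : ℕ) : Fin 27) + (n - w ((b - 1 : ℕ) : Fin 27)) = n + c by
    rw [← h]; ring] at h2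

lemma fOp_isWeightedHomogeneous_wt {g : A} {n : ℤ} (k : ℕ) (hg : IsWeightedHomogeneous wt g n) :
    IsWeightedHomogeneous wt (fOp k g) (n + if k = 6 then 1 else 0) := by
  unfold fOp
  split <;> simp only [LinearMap.sub_apply, LinearMap.add_apply, LinearMap.zero_apply]
  case h_7 => exact isWeightedHomogeneous_zero _ _ _
  all_goals
    repeat' with_reducible_and_instances
      first | apply IsWeightedHomogeneous.sub | apply IsWeightedHomogeneous.add
    all_goals exact md_isWeightedHomogeneous _ _ hg (by decide)

lemma fOp_isWeightedHomogeneous_wtDual {g : A} {n : ℤ} (k : ℕ)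
    (hg : IsWeightedHomogeneous wtDual g n) :
    IsWeightedHomogeneous wtDual (fOp k g) (n + if k = 1 then -1 else 0) := by
  unfold fOp
  split <;> simp only [LinearMap.sub_apply, LinearMap.add_apply, LinearMap.zero_apply]
  case h_7 => exact isWeightedHomogeneous_zero _ _ _
  all_goals
    repeat' with_reducible_and_instances
      first | apply IsWeightedHomogeneous.sub | apply IsWeightedHomogeneous.add
    all_goals exact md_isWeightedHomogeneous _ _ hg (by decide)

lemma xv_mul_xv_isWeightedHomogeneous {w : Fin 27 → ℤ} {n : ℤ} (a b : ℕ)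
    (h : w ((a - 1 : ℕ) : Fin 27) + w ((b - 1 : ℕ) : Fin 27) = n) :
    IsWeightedHomogeneous w (xv a * xv b) n :=
  h ▸ (isWeightedHomogeneous_X ℂ w _).mul (isWeightedHomogeneous_X ℂ w _)

lemma z1_isWeightedHomogeneous_wt : IsWeightedHomogeneous wt z1 0 :=
  ((((xv_mul_xv_isWeightedHomogeneous 1 14 (by decide)).add
    (xv_mul_xv_isWeightedHomogeneous 2 11 (by decide))).add
    (xv_mul_xv_isWeightedHomogeneous 3 9 (by decide))).sub
    (xv_mul_xv_isWeightedHomogeneous 4 7 (by decide))).add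
    (xv_mul_xv_isWeightedHomogeneous 5 6 (by decide))

lemma z1_isWeightedHomogeneous_wtDual : IsWeightedHomogeneous wtDual z1 2 :=
  ((((xv_mul_xv_isWeightedHomogeneous 1 14 (by decide)).add
    (xv_mul_xv_isWeightedHomogeneous 2 11 (by decide))).add
    (xv_mul_xv_isWeightedHomogeneous 3 9 (by decide))).sub
    (xv_mul_xv_isWeightedHomogeneous 4 7 (by decide))).add
    (xv_mul_xv_isWeightedHomogeneous 5 6 (by decide))

lemma Imo_zeta_apply_eq_zero {v : A} (hv : ∀ j, wt j ≠ 0 → pdE j v = 0) {i : ℕ} (hi : i ≠ 1) :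
    Imo (zeta i) v = 0 := by
  have f {k g n} := @fOp_isWeightedHomogeneous_wt g n k
  have fd {k g n} := @fOp_isWeightedHomogeneous_wtDual g n k
  have h2 := f (k := 6) z1_isWeightedHomogeneous_wt
  have h4 := f (k := 4) (f (k := 5) h2)
  have h5 := f (k := 3) h4
  have h7 := f (k := 3) (f (k := 2) h4)
  have h9 := f (k := 4) h7
  have h10 := f (k := 1) h7
  have h11 := (f (k := 5) h9).neg
  have h12 := f (k := 4) h10
  have t1 := z1_isWeightedHomogeneous_wtDual
  have t2 := fd (k := 6) t1
  have t3 := fd (k := 5) t2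
  have t4 := fd (k := 4) t3
  have t5 := fd (k := 3) t4
  have t6 := fd (k := 2) t4
  have t7 := fd (k := 3) t6
  have t9 := fd (k := 4) t7
  have t10 := fd (k := 1) t7
  have up {g : A} {n : ℤ} (hg : IsWeightedHomogeneous wt g n) (hn : n ≠ 0) :=
    Imo_apply_eq_zero_of_weight hv hg hn
  have down {g : A} {n : ℤ} (hg : IsWeightedHomogeneous wtDual g n) (hn : n ≠ 0) :=
    Imo_tau_apply_eq_zero hv hg hn
  unfold zeta
  split
  · exact absurd rfl hi
  · exact up h2 (by decide)
  · exact up (f (k := 5) h2) (by decide)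
  · exact up h4 (by decide)
  · exact up h5 (by decide)
  · exact up (f (k := 2) h4) (by decide)
  · exact up h7 (by decide)
  · exact up (f (k := 1) h5) (by decide)
  · exact up h9 (by decide)
  · exact up h10 (by decide)
  · exact up h11 (by decide)
  · exact up h12 (by decide)
  · exact up (f (k := 3) h12) (by decide)
  · exact up (f (k := 6) h11).neg (by decide)
  · exact up (f (k := 5) h12).neg (by decide)
  · exact down (fd (k := 4) t10) (by decide)
  · exact down (fd (k := 5) t9).neg (by decide)
  · exact down t10 (by decide)
  · exact down t9 (by decide)
  · exact down (fd (k := 1) t5) (by decide)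
  · exact down t7 (by decide)
  · exact down t6 (by decide)
  · exact down t5 (by decide)
  · exact down t4 (by decide)
  · exact down t3 (by decide)
  · exact down t2 (by decide)
  · exact down t1 (by decide)
  · simp [Imo]

lemma z1_eq : z1 = X 0 * X 13 + X 1 * X 10 + X 2 * X 8 - X 3 * X 6 + X 4 * X 5 := rfl

lemma Imo_z1 : Imo z1 =
    pdE 0 * pdE 13 + pdE 1 * pdE 10 + pdE 2 * pdE 8 - pdE 3 * pdE 6 + pdE 4 * pdE 5 := by
  simp only [z1_eq, Imo_add, Imo_sub, Imo_X_mul_X]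

lemma pdE_X_pow_mul_z1_pow_eq_zero (m1 m2 : ℕ) (j : Fin 27) (hj : wt j ≠ 0) :
    pdE j (xv 1 ^ m1 * z1 ^ m2) = 0 := by
  have hx : pderiv j (xv 1) = 0 := by
    refine pderiv_X_of_ne ?_
    rintro rfl
    exact hj (by decide)
  have hz : pderiv j z1 = 0 := by
    have hne : ∀ i, wt i = 0 → pderiv j (X i : A) = 0 := fun i hi =>
      pderiv_X_of_ne fun h => hj (h ▸ hi)
    have hS : ∀ i : Fin 27, i = 0 ∨ i = 1 ∨ i = 2 ∨ i = 3 ∨ i = 4 ∨ i = 5 ∨ i = 6 ∨ i = 8 ∨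
        i = 10 ∨ i = 13 → pderiv j (X i : A) = 0 := fun i hi =>
      hne i (by revert i; decide)
    simp [z1_eq, hS]
  simp [pdE, hx, hz]

lemma Imo_z1_apply (m1 m2 : ℕ) :
    Imo z1 (xv 1 ^ m1 * z1 ^ (m2 + 1)) =
      (((m2 + 1) * (m1 + m2 + 5) : ℕ) : A) * (xv 1 ^ m1 * z1 ^ m2) := by
  have d0 : pderiv 0 z1 = X 13 := by simp [z1_eq, pderiv_X]
  have d1 : pderiv 1 z1 = X 10 := by simp [z1_eq, pderiv_X]
  have d2 : pderiv 2 z1 = X 8 := by simp [z1_eq, pderiv_X]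
  have d3 : pderiv 3 z1 = -X 6 := by simp [z1_eq, pderiv_X]
  have d4 : pderiv 4 z1 = X 5 := by simp [z1_eq, pderiv_X]
  have d5 : pderiv 5 z1 = X 4 := by simp [z1_eq, pderiv_X]
  have d6 : pderiv 6 z1 = -X 3 := by simp [z1_eq, pderiv_X]
  have d8 : pderiv 8 z1 = X 2 := by simp [z1_eq, pderiv_X]
  have d10 : pderiv 10 z1 = X 1 := by simp [z1_eq, pderiv_X]
  have d13 : pderiv 13 z1 = X 0 := by simp [z1_eq, pderiv_X]
  have hx : xv 1 = X 0 := rfl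
  rw [Imo_z1, hx]
  simp only [LinearMap.add_apply, LinearMap.sub_apply, Module.End.mul_apply, pdE,
    Derivation.coeFn_coe]
  have hfirst (j : Fin 27) (hj : j ≠ 0) : pderiv j (X 0 ^ m1 * z1 ^ (m2 + 1)) =
      (m2 + 1 : A) * (X 0 ^ m1 * (z1 ^ m2 * pderiv j z1)) := by
    simp [pderiv_X_of_ne hj.symm]
    ring
  rw [hfirst 13 (by decide), hfirst 10 (by decide), hfirst 8 (by decide), hfirst 6 (by decide),
    hfirst 5 (by decide), d13, d10, d8, d6, d5]
  cases m2 with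
  | zero => cases m1 <;> simp [pderiv_X] <;> ring
  | succ n =>
    cases m1 <;> simp [d0, d1, d2, d3, d4, pderiv_X]
    · linear_combination (-(n + 1 + 1) * (n + 1) * z1 ^ n : A) * z1_eq
    · rename_i k
      linear_combination (-((n : A) + 1 + 1) * (n + 1) * (X 0 : A) ^ (k + 1) * z1 ^ n) * z1_eq

lemma Imo_z1_X_pow (m : ℕ) : Imo z1 (xv 1 ^ m) = 0 := by
  have hx (j : Fin 27) (hj : j ≠ 0) : pdE j (xv 1 ^ m) = 0 := by
    simp [pdE, xv, pderiv_X_of_ne hj.symm]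
  simp [Imo_z1, hx]

/-- `D₂(x₁^{m₁} ζ₁^{m₂}) = m₂(m₁+m₂+4) x₁^{m₁} ζ₁^{m₂}`. -/
theorem stmt10 (m1 m2 : ℕ) :
    D2 (xv 1 ^ m1 * zeta 1 ^ m2) =
      ((m2 * (m1 + m2 + 4) : ℕ) : ℂ) • (xv 1 ^ m1 * zeta 1 ^ m2) := by
  have hz : zeta 1 = z1 := rfl
  rw [hz, D2, LinearMap.sum_apply, Finset.sum_eq_single_of_mem 1 (by simp) fun i _ hi => ?_]
  · rw [LinearMap.comp_apply, LinearMap.mulLeft_apply, hz]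
    cases m2 with
    | zero => simp [Imo_z1_X_pow]
    | succ m2 =>
      rw [Imo_z1_apply, smul_eq_C_mul, map_natCast]
      push_cast
      ring
  · rw [LinearMap.comp_apply,
      Imo_zeta_apply_eq_zero (pdE_X_pow_mul_z1_pow_eq_zero m1 m2) hi, map_zero]

end
end

section
/- Each L(m_1, m_2) is finite-dimensional over ℂ, and for every m ∈ ℕ the binomial coefficient C(m+26, 26) equals the sum of dim_ℂ L(m_1, m_2) over all triples (m_1, m_2, m_3) of nonnegative integers with m_1 + 2m_2 + 3m_3 = m. (This is the dimension identity equivalent to (1−q)^{26} · Σ_{m_1,m_2≥0} dim V(m_1λ_1 + m_2λ_6) q^{m_1+2m_2} = 1 + q + q^2 for irreducible E_6-modules.) -/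
open MvPolynomial
open scoped Fin.NatCast

noncomputable section

/-- `L(m₁, m₂)`: the smallest submodule of `A` (invariant under all twelve
derivations) containing `x₁^{m₁} ζ₁^{m₂}`. -/
def Lmod (m1 m2 : ℕ) : Submodule ℂ A :=
  sInf {W : Submodule ℂ A | xv 1 ^ m1 * zeta 1 ^ m2 ∈ W ∧
    ∀ i : ℕ, 1 ≤ i → i ≤ 6 → ∀ p ∈ W, eOp i p ∈ W ∧ fOp i p ∈ W}

/-! ### Derivations given by linear vector fields -/

/-- The derivation `∑ c x_a ∂_b` of the polynomial ring, the sum running over the triples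
`(a, b, c)` in the list. -/
def linDer {σ : Type*} (L : List (σ × σ × ℤ)) :
    Derivation ℂ (MvPolynomial σ ℂ) (MvPolynomial σ ℂ) :=
  (L.map fun t => (t.2.2 : ℂ) • ((X t.1 : MvPolynomial σ ℂ) • pderiv t.2.1)).sum

/-- The commutator of two linear vector fields, as a list of triples. -/
def bracketList {σ : Type*} [DecidableEq σ] (L M : List (σ × σ × ℤ)) : List (σ × σ × ℤ) :=
  L.flatMap fun s => M.flatMap fun t =>
    (if s.2.1 = t.1 then [(s.1, t.2.1, s.2.2 * t.2.2)] else []) ++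
      (if t.2.1 = s.1 then [(t.1, s.2.1, -(s.2.2 * t.2.2))] else [])

/-- The negative transpose of a linear vector field. -/
def negTranspose {σ : Type*} (L : List (σ × σ × ℤ)) : List (σ × σ × ℤ) :=
  L.map fun t => (t.2.1, t.1, -t.2.2)

section LinDer

variable {σ : Type*}

lemma linDer_nil : linDer ([] : List (σ × σ × ℤ)) = 0 := rfl

lemma linDer_cons (t : σ × σ × ℤ) (L : List (σ × σ × ℤ)) :
    linDer (t :: L) = (t.2.2 : ℂ) • ((X t.1 : MvPolynomial σ ℂ) • pderiv t.2.1) + linDer L := by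
  simp [linDer]

lemma linDer_append (L M : List (σ × σ × ℤ)) : linDer (L ++ M) = linDer L + linDer M := by
  simp [linDer]

lemma linDer_perm {L M : List (σ × σ × ℤ)} (h : L.Perm M) : linDer L = linDer M :=
  (h.map _).sum_eq

lemma linDer_map_neg (L : List (σ × σ × ℤ)) :
    linDer (L.map fun t => (t.1, t.2.1, -t.2.2)) = -linDer L := by
  induction L with
  | nil => simp [linDer_nil]
  | cons t L ih => simp only [List.map_cons, linDer_cons, ih]; push_cast; module

lemma linDer_eq_zero_of_perm_neg {L : List (σ × σ × ℤ)}
    (h : L.Perm (L.map fun t => (t.1, t.2.1, -t.2.2))) : linDer L = 0 := by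
  have := linDer_perm h
  rw [linDer_map_neg] at this
  refine Derivation.ext fun p => ?_
  have hp := congrArg (fun D => D p) this
  exact self_eq_neg.mp hp

lemma linDer_cons_X [DecidableEq σ] (t : σ × σ × ℤ) (L : List (σ × σ × ℤ)) (k : σ) :
    linDer (t :: L) (X k) =
      (if t.2.1 = k then (t.2.2 : ℂ) • (X t.1 : MvPolynomial σ ℂ) else 0) + linDer L (X k) := by
  rw [linDer_cons]
  by_cases h : t.2.1 = k
  · subst h; simp
  · simp [h, pderiv_X_of_ne (Ne.symm h)]

lemma lie_smul_X_pderiv [DecidableEq σ] (s t : σ × σ × ℤ) :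
    ⁅(s.2.2 : ℂ) • ((X s.1 : MvPolynomial σ ℂ) • pderiv (R := ℂ) s.2.1),
      (t.2.2 : ℂ) • ((X t.1 : MvPolynomial σ ℂ) • pderiv (R := ℂ) t.2.1)⁆ =
    linDer ((if s.2.1 = t.1 then [(s.1, t.2.1, s.2.2 * t.2.2)] else []) ++
      (if t.2.1 = s.1 then [(t.1, s.2.1, -(s.2.2 * t.2.2))] else [])) := by
  obtain ⟨a, b, c⟩ := s
  obtain ⟨a', b', c'⟩ := t
  refine MvPolynomial.derivation_ext fun k => ?_
  simp only [Derivation.commutator_apply, Derivation.smul_apply, linDer_append,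
    Derivation.add_apply, pderiv_X, Pi.single_apply, smul_eq_mul]
  split_ifs <;> subst_vars <;>
    simp_all [linDer_nil, linDer_cons, pderiv_X, eq_comm, smul_smul, mul_comm]

lemma linDer_commutator [DecidableEq σ] (L M : List (σ × σ × ℤ)) (p : MvPolynomial σ ℂ) :
    linDer L (linDer M p) - linDer M (linDer L p) = linDer (bracketList L M) p := by
  induction L with
  | nil => simp [bracketList, linDer_nil]
  | cons s L ih =>
    have h : linDer [s] (linDer M p) - linDer M (linDer [s] p) = linDer (bracketList [s] M) p := by
      clear ih
      induction M with
      | nil => simp [bracketList, linDer_nil]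
      | cons t M ih =>
        have hst := congrArg (fun D => D p) (lie_smul_X_pderiv s t)
        simp only [Derivation.commutator_apply] at hst
        have hb : bracketList [s] (t :: M) = bracketList [s] [t] ++ bracketList [s] M := by
          simp [bracketList]
        have hb' : bracketList [s] [t] =
            (if s.2.1 = t.1 then [(s.1, t.2.1, s.2.2 * t.2.2)] else []) ++
              (if t.2.1 = s.1 then [(t.1, s.2.1, -(s.2.2 * t.2.2))] else []) := by
          simp [bracketList]
        rw [hb, linDer_append, Derivation.add_apply, ← ih, hb', ← hst]
        simp only [linDer_cons, linDer_nil, add_zero, Derivation.add_apply, map_add]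
        abel
    have hb : bracketList (s :: L) M = bracketList [s] M ++ bracketList L M := by
      simp [bracketList]
    rw [hb, linDer_append, Derivation.add_apply, ← ih, ← h]
    simp only [linDer_cons, linDer_nil, add_zero, Derivation.add_apply, map_add]
    abel

lemma linDer_commutator_of_diagonal [DecidableEq σ] {H : List (σ × σ × ℤ)} {w : σ → ℤ}
    (hH : ∀ k, linDer H (X k) = (w k : ℂ) • (X k : MvPolynomial σ ℂ))
    {L : List (σ × σ × ℤ)} {n : ℤ} (hL : ∀ t ∈ L, w t.1 - w t.2.1 = n) (p : MvPolynomial σ ℂ) :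
    linDer H (linDer L p) - linDer L (linDer H p) = (n : ℂ) • linDer L p := by
  suffices h : ⁅linDer H, linDer L⁆ = (n : ℂ) • linDer L by
    simpa [Derivation.commutator_apply] using congrArg (fun D => D p) h
  refine MvPolynomial.derivation_ext fun k => ?_
  rw [Derivation.commutator_apply, hH, Derivation.map_smul, Derivation.smul_apply]
  induction L with
  | nil => simp [linDer_nil]
  | cons t L ih =>
    have ih := ih fun s hs => hL s (List.mem_cons_of_mem _ hs)
    have ht := hL t List.mem_cons_self
    rw [linDer_cons_X, map_add]
    split_ifs with h
    · subst h
      rw [Derivation.map_smul, hH, smul_add, smul_add, ← ih, ← ht]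
      push_cast
      module
    · simpa using ih

lemma linDer_isHomogeneous (L : List (σ × σ × ℤ)) {p : MvPolynomial σ ℂ} {n : ℕ}
    (hp : p.IsHomogeneous n) : (linDer L p).IsHomogeneous n := by
  induction L with
  | nil => simpa [linDer_nil] using isHomogeneous_zero σ ℂ n
  | cons t L ih =>
    rw [linDer_cons, Derivation.add_apply]
    refine IsHomogeneous.add ?_ ih
    rw [Derivation.smul_apply, Derivation.smul_apply, smul_eq_mul, smul_eq_C_mul]
    refine (IsHomogeneous.C_mul ?_ _)
    rcases Nat.eq_zero_or_pos n with rfl | hn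
    · have h0 : p.totalDegree = 0 := Nat.le_zero.mp hp.totalDegree_le
      rw [totalDegree_eq_zero_iff_eq_C.mp h0]
      simpa using isHomogeneous_zero σ ℂ 0
    · simpa [Nat.add_sub_cancel' hn] using (isHomogeneous_X ℂ t.1).mul (hp.pderiv (i := t.2.1))

end LinDer

/-! ### The Fischer inner product -/

/-- The Fischer inner product of polynomials, for which monomials are orthogonal and `x_i` is
adjoint to `∂_i`. -/
def fischer {σ : Type*} (p q : MvPolynomial σ ℂ) : ℂ :=
  ∑ d ∈ p.support, ((d.prod fun _ n => n.factorial : ℕ) : ℂ) * star (coeff d p) * coeff d q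

section Fischer

variable {σ : Type*}

lemma fischer_eq_sum {p : MvPolynomial σ ℂ} {S : Finset (σ →₀ ℕ)} (h : p.support ⊆ S)
    (q : MvPolynomial σ ℂ) :
    fischer p q =
      ∑ d ∈ S, ((d.prod fun _ n => n.factorial : ℕ) : ℂ) * star (coeff d p) * coeff d q :=
  Finset.sum_subset h fun d _ hd => by simp [notMem_support_iff.mp hd]

lemma fischer_star (p q : MvPolynomial σ ℂ) : star (fischer q p) = fischer p q := by
  classical
  rw [fischer_eq_sum (p := p) (Finset.subset_union_left (s₂ := q.support)),
    fischer_eq_sum (p := q) (Finset.subset_union_right (s₁ := p.support)), star_sum]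
  refine Finset.sum_congr rfl fun d _ => ?_
  simp only [star_mul', star_star, star_natCast]
  ring

lemma fischer_add_left (p q r : MvPolynomial σ ℂ) :
    fischer (p + q) r = fischer p r + fischer q r := by
  rw [← fischer_star (p + q), ← fischer_star p, ← fischer_star q, ← star_add]
  simp [fischer, mul_add, Finset.sum_add_distrib]

lemma fischer_smul_left (p q : MvPolynomial σ ℂ) (c : ℂ) :
    fischer (c • p) q = star c * fischer p q := by
  rw [← fischer_star (c • p), ← fischer_star p, ← star_mul']
  simp [fischer, Finset.mul_sum, mul_left_comm]

/-- The Fischer inner product as an inner product space structure. -/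
@[reducible] def fischerCore (σ : Type*) : InnerProductSpace.Core ℂ (MvPolynomial σ ℂ) where
  inner := fischer
  conj_inner_symm := fischer_star
  re_inner_nonneg p := by
    simp only [fischer, map_sum]
    refine Finset.sum_nonneg fun d _ => ?_
    have h : star (coeff d p) * coeff d p = (Complex.normSq (coeff d p) : ℂ) :=
      (Complex.normSq_eq_conj_mul_self).symm
    rw [mul_assoc, h, ← Complex.ofReal_natCast, ← Complex.ofReal_mul]
    exact mul_nonneg (Nat.cast_nonneg _) (Complex.normSq_nonneg _)
  add_left := fischer_add_left
  smul_left := fischer_smul_left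
  definite p hp := by
    have h : ∀ d, ((d.prod fun _ n => n.factorial : ℕ) : ℂ) * star (coeff d p) * coeff d p =
        (((d.prod fun _ n => n.factorial : ℕ) * Complex.normSq (coeff d p) : ℝ) : ℂ) := fun d => by
      have h : star (coeff d p) * coeff d p = (Complex.normSq (coeff d p) : ℂ) :=
        (Complex.normSq_eq_conj_mul_self).symm
      rw [mul_assoc, h, Complex.ofReal_mul, Complex.ofReal_natCast]
    change fischer p p = 0 at hp
    rw [fischer, Finset.sum_congr rfl fun d _ => h d, ← Complex.ofReal_sum,
      Complex.ofReal_eq_zero, Finset.sum_eq_zero_iff_of_nonneg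
        fun d _ => mul_nonneg (Nat.cast_nonneg _) (Complex.normSq_nonneg _)] at hp
    ext d
    by_contra hd
    have hd' : coeff d p ≠ 0 := by simpa using hd
    rcases mul_eq_zero.mp (hp d (mem_support_iff.mpr hd')) with h0 | h0
    · exact (Finset.prod_ne_zero_iff.mpr fun i _ => Nat.factorial_ne_zero _)
        (Nat.cast_eq_zero.mp h0)
    · exact hd' (Complex.normSq_eq_zero.mp h0)

lemma fischer_X_mul_left (i : σ) (p q : MvPolynomial σ ℂ) :
    fischer (X i * p) q = fischer p (pderiv i q) := by
  classical
  rw [fischer, support_X_mul, Finset.sum_map, fischer]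
  refine Finset.sum_congr rfl fun d _ => ?_
  have hf : ((Finsupp.single i 1 + d).prod fun _ n => n.factorial) =
      (d i + 1) * d.prod fun _ n => n.factorial := by
    have hs : ∀ e : σ →₀ ℕ, e.support ⊆ insert i d.support →
        (e.prod fun _ n => n.factorial) = (e i).factorial *
          ∏ j ∈ d.support.erase i, (e j).factorial := fun e he => by
      rw [Finsupp.prod_of_support_subset e he _ (by simp),
        ← Finset.insert_erase (Finset.mem_insert_self i _),
        Finset.prod_insert (by simp), Finset.erase_insert_eq_erase]
    rw [hs _ ?_, hs d (Finset.subset_insert _ _)]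
    · rw [← mul_assoc]
      congr 1
      · simp [add_comm 1, Nat.factorial_succ]
      · refine Finset.prod_congr rfl fun j hj => ?_
        simp [Finsupp.single_eq_of_ne (Finset.ne_of_mem_erase hj)]
    · refine Finsupp.support_add.trans ?_
      rw [Finset.insert_eq]
      exact Finset.union_subset_union Finsupp.support_single_subset subset_rfl
  simp only [addLeftEmbedding_apply, coeff_X_mul, coeff_pderiv, hf]
  rw [add_comm d]
  push_cast
  ring

lemma fischer_pderiv_left (i : σ) (p q : MvPolynomial σ ℂ) :
    fischer (pderiv i p) q = fischer p (X i * q) := by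
  rw [← fischer_star, ← fischer_X_mul_left, fischer_star]

lemma fischer_linDer_left (L : List (σ × σ × ℤ)) (p q : MvPolynomial σ ℂ) :
    fischer (linDer L p) q = -fischer p (linDer (negTranspose L) q) := by
  have hadd : ∀ a b : MvPolynomial σ ℂ, fischer p (a + b) = fischer p a + fischer p b :=
    fun a b => by simp [fischer, mul_add, Finset.sum_add_distrib]
  have hsmul : ∀ (c : ℂ) (a : MvPolynomial σ ℂ), fischer p (c • a) = c * fischer p a :=
    fun c a => by simp [fischer, Finset.mul_sum, mul_left_comm]
  induction L with
  | nil => simp [linDer_nil, negTranspose, fischer]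
  | cons t L ih =>
    have hL : negTranspose (t :: L) = (t.2.1, t.1, -t.2.2) :: negTranspose L := rfl
    rw [hL, linDer_cons, linDer_cons]
    simp only [Derivation.add_apply, Derivation.smul_apply, fischer_add_left, hadd, hsmul,
      fischer_smul_left, ih, smul_eq_mul, fischer_X_mul_left, fischer_pderiv_left]
    simp [add_comm]

end Fischer

/-! ### Flows of linear vector fields -/

section Flow

variable {σ : Type*}

lemma linDer_X_eq_zero (L : List (σ × σ × ℤ)) {k : σ} (h : ∀ t ∈ L, t.2.1 ≠ k) :
    linDer L (X k) = 0 := by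
  classical
  induction L with
  | nil => simp [linDer_nil]
  | cons t L ih =>
    rw [linDer_cons_X, if_neg (h t List.mem_cons_self), zero_add,
      ih fun s hs => h s (List.mem_cons_of_mem _ hs)]

/-- The constants of a linear vector field of square zero are invariant under its flow. -/
lemma eval_flow_eq {L : List (σ × σ × ℤ)} (hL : ∀ s ∈ L, ∀ t ∈ L, t.2.1 ≠ s.1)
    {p : MvPolynomial σ ℂ} (hp : linDer L p = 0) (x : σ → ℂ) (t : ℂ) :
    eval (fun k => x k + t * eval x (linDer L (X k))) p = eval x p := by
  classical
  let g : MvPolynomial σ ℂ →ₐ[ℂ] Polynomial ℂ :=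
    aeval fun k => Polynomial.C (x k) + Polynomial.X * Polynomial.C (eval x (linDer L (X k)))
  have hlin : ∀ (M : List (σ × σ × ℤ)) (k : σ), (∀ s ∈ M, linDer L (X s.1) = 0) →
      g (linDer M (X k)) = Polynomial.C (eval x (linDer M (X k))) := by
    intro M k hM
    induction M with
    | nil => simp [linDer_nil]
    | cons s M ih =>
      rw [linDer_cons_X, map_add, map_add, Polynomial.C_add,
        ih fun s hs => hM s (List.mem_cons_of_mem _ hs)]
      split_ifs
      · have hs := hM s List.mem_cons_self
        simp [g, hs, Polynomial.smul_eq_C_mul]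
      · simp
  have hg : ∀ k, g (linDer L (X k)) = Polynomial.C (eval x (linDer L (X k))) := fun k =>
    hlin L k fun s hs => linDer_X_eq_zero L fun t ht => hL s hs t ht
  have hder : ∀ q, Polynomial.derivative (g q) = g (linDer L q) := by
    intro q
    induction q using MvPolynomial.induction_on with
    | C a =>
      have h1 : g (C a) = Polynomial.C a := by simp [g]
      simp [h1]
    | add q r hq hr => simp [hq, hr]
    | mul_X q k hq =>
      rw [Derivation.leibniz, map_mul, Polynomial.derivative_mul, hq, map_add]
      simp only [smul_eq_mul, map_mul, hg]
      simp only [g, aeval_X]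
      simp
      ring
  have h0 : Polynomial.derivative (g p) = 0 := by rw [hder, hp, map_zero]
  obtain ⟨c, hc⟩ := Polynomial.natDegree_eq_zero.mp
    (Polynomial.derivative_eq_zero.mp h0)
  have heval : ∀ (s : ℂ) (q : MvPolynomial σ ℂ), Polynomial.eval s (g q) =
      eval (fun k => x k + s * eval x (linDer L (X k))) q := by
    intro s q
    induction q using MvPolynomial.induction_on with
    | C a => simp [g]
    | add q r hq hr => simp [hq, hr]
    | mul_X q k hq => rw [map_mul, Polynomial.eval_mul, hq, map_mul]; congr 1; simp [g]; ring
  have h1 := heval t p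
  have h2 := heval 0 p
  rw [← hc, Polynomial.eval_C] at h1 h2
  rw [← h1, h2]
  simp

end Flow

/-! ### The `E₆` root vectors -/

/-- The simple positive root vectors of `E₆` as linear vector fields on the 27-dimensional
representation. -/
def simpleRoot : Fin 6 → List (Fin 27 × Fin 27 × ℤ)
  | 0 => [(0, 1, -1), (10, 13, 1), (14, 16, 1), (15, 18, 1), (17, 20, 1), (19, 22, 1)]
  | 1 => [(3, 5, -1), (4, 6, -1), (7, 9, -1), (17, 19, 1), (20, 22, 1), (21, 23, 1)]
  | 2 => [(1, 2, -1), (8, 10, 1), (11, 14, 1), (12, 15, 1), (20, 21, 1), (22, 23, 1)]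
  | 3 => [(2, 3, -1), (6, 8, -1), (9, 11, -1), (15, 17, -1), (18, 20, -1), (23, 24, 1)]
  | 4 => [(3, 4, -1), (5, 6, -1), (11, 12, -1), (14, 15, -1), (16, 18, -1), (24, 25, 1)]
  | 5 => [(4, 7, -1), (6, 9, -1), (8, 11, -1), (10, 14, -1), (13, 16, -1), (25, 26, 1)]

/-- The left-normed commutator of simple root vectors spelled by a word, read from the right. -/
def wordRoot : List (Fin 6) → List (Fin 27 × Fin 27 × ℤ)
  | [] => []
  | [i] => simpleRoot i
  | i :: w => bracketList (wordRoot w) (simpleRoot i)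

/-- The weights of degree one above the highest weight, for the grading of the 27-dimensional
representation as `1 + 16 + 10` under `D₅`. -/
def spinIndices : Finset (Fin 27) := {1, 2, 3, 4, 5, 6, 7, 8, 9, 10, 11, 12, 14, 15, 17, 19}

/-- Words for the root vectors with matrix coefficient `x_0 ∂_j`, for `j` a spin index. -/
def spinWord : Fin 27 → List (Fin 6)
  | 1 => [0]
  | 2 => [2, 0]
  | 3 => [3, 2, 0]
  | 4 => [4, 3, 2, 0]
  | 5 => [1, 3, 2, 0]
  | 6 => [4, 1, 3, 2, 0]
  | 7 => [5, 4, 3, 2, 0]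
  | 8 => [3, 4, 1, 3, 2, 0]
  | 9 => [5, 4, 1, 3, 2, 0]
  | 10 => [2, 3, 4, 1, 3, 2, 0]
  | 11 => [5, 3, 4, 1, 3, 2, 0]
  | 12 => [4, 5, 3, 4, 1, 3, 2, 0]
  | 14 => [5, 2, 3, 4, 1, 3, 2, 0]
  | 15 => [4, 5, 2, 3, 4, 1, 3, 2, 0]
  | 17 => [3, 4, 5, 2, 3, 4, 1, 3, 2, 0]
  | 19 => [1, 3, 4, 5, 2, 3, 4, 1, 3, 2, 0]
  | _ => []

/-- The middle weights of the vector representation of `D₅`. -/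
def vectorIndices : Finset (Fin 27) := {16, 18, 20, 21, 22, 23, 24, 25}

/-- Words for the root vectors of `D₅` with matrix coefficient `x_13 ∂_j`, for `j` a vector
index. -/
def vectorWord : Fin 27 → List (Fin 6)
  | 16 => [5]
  | 18 => [4, 5]
  | 20 => [3, 4, 5]
  | 21 => [2, 3, 4, 5]
  | 22 => [1, 3, 4, 5]
  | 23 => [2, 1, 3, 4, 5]
  | 24 => [3, 2, 1, 3, 4, 5]
  | 25 => [4, 3, 2, 1, 3, 4, 5]
  | _ => []

/-- The invariant cubic form of `E₆`. -/
def cubicForm : A :=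
  X 0 * X 13 * X 26 + X 0 * X 16 * X 25 + X 0 * X 18 * X 24 + X 0 * X 20 * X 23
    - X 0 * X 21 * X 22 + X 1 * X 10 * X 26 + X 1 * X 14 * X 25 + X 1 * X 15 * X 24
    + X 1 * X 17 * X 23 - X 1 * X 19 * X 21 + X 2 * X 8 * X 26 + X 2 * X 11 * X 25
    + X 2 * X 12 * X 24 + X 2 * X 17 * X 22 - X 2 * X 19 * X 20 - X 3 * X 6 * X 26
    - X 3 * X 9 * X 25 + X 3 * X 12 * X 23 - X 3 * X 15 * X 22 + X 3 * X 18 * X 19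
    + X 4 * X 5 * X 26 - X 4 * X 9 * X 24 - X 4 * X 11 * X 23 + X 4 * X 14 * X 22
    - X 4 * X 16 * X 19 + X 5 * X 7 * X 25 + X 5 * X 12 * X 21 - X 5 * X 15 * X 20
    + X 5 * X 17 * X 18 + X 6 * X 7 * X 24 - X 6 * X 11 * X 21 + X 6 * X 14 * X 20
    - X 6 * X 16 * X 17 + X 7 * X 8 * X 23 - X 7 * X 10 * X 22 + X 7 * X 13 * X 19
    + X 8 * X 9 * X 21 - X 8 * X 14 * X 18 + X 8 * X 15 * X 16 - X 9 * X 10 * X 20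
    + X 9 * X 13 * X 17 + X 10 * X 11 * X 18 - X 10 * X 12 * X 16 - X 11 * X 13 * X 15
    + X 12 * X 13 * X 14

/-- A polynomial is singular if it is annihilated by the positive root vectors. -/
def IsSingular (p : A) : Prop := ∀ i, linDer (simpleRoot i) p = 0

lemma eOp_eq (i : Fin 6) (p : A) : eOp (i + 1) p = linDer (simpleRoot i) p := by
  fin_cases i <;>
  · simp [eOp, simpleRoot, linDer_cons, linDer_nil, md, pdE, xv]
    ring

lemma fOp_eq (i : Fin 6) (p : A) : fOp (i + 1) p = linDer (negTranspose (simpleRoot i)) p := by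
  fin_cases i <;>
  · simp [fOp, simpleRoot, negTranspose, linDer_cons, linDer_nil, md, pdE, xv]
    ring

lemma isSingular_X_zero : IsSingular (X 0) := by
  intro i
  apply linDer_X_eq_zero
  revert i
  decide

lemma zeta_one : zeta 1 = X 0 * X 13 + X 1 * X 10 + X 2 * X 8 - X 3 * X 6 + X 4 * X 5 := by
  simp [zeta, z1, xv]

lemma isSingular_zeta_one : IsSingular (zeta 1) := by
  intro i
  rw [zeta_one]
  fin_cases i <;>
  · simp [simpleRoot, linDer_cons_X, linDer_nil, Derivation.leibniz]
    try ring

lemma linDer_simpleRoot_cubicForm (i : Fin 6) : linDer (simpleRoot i) cubicForm = 0 := by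
  fin_cases i <;>
  · simp only [cubicForm, simpleRoot, linDer_cons_X, linDer_nil, Derivation.leibniz,
      map_add, map_sub, smul_eq_mul]
    simp
    ring

lemma linDer_negTranspose_cubicForm (i : Fin 6) :
    linDer (negTranspose (simpleRoot i)) cubicForm = 0 := by
  fin_cases i <;>
  · simp only [cubicForm, simpleRoot, negTranspose, List.map, linDer_cons_X, linDer_nil,
      Derivation.leibniz, map_add, map_sub, smul_eq_mul]
    simp
    ring

/-! ### Singular polynomials -/

lemma IsSingular.wordRoot {p : A} (hp : IsSingular p) (w : List (Fin 6)) :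
    linDer (wordRoot w) p = 0 := by
  induction w with
  | nil => simp [_root_.wordRoot, linDer_nil]
  | cons i w ih =>
    match w with
    | [] => exact hp i
    | j :: w =>
      change linDer (bracketList (_root_.wordRoot (j :: w)) (simpleRoot i)) p = 0
      rw [← linDer_commutator, ih, hp i, map_zero, map_zero, sub_zero]

lemma linDer_X_eq_linDer_filter {σ : Type*} [DecidableEq σ] (L : List (σ × σ × ℤ)) (k : σ) :
    linDer L (X k) = linDer (L.filter fun t => t.2.1 = k) (X k) := by
  induction L with
  | nil => rfl
  | cons t L ih =>
    by_cases h : t.2.1 = k <;> simp [h, linDer_cons_X, ih]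

/-- A root vector with matrix coefficient `x_a ∂_j` moves points with `x_a ≠ 0` to points with
`x_j = 0`. -/
lemma exists_eval_eq_of_root {w : List (Fin 6)} {a j : Fin 27} {c : ℤ} (hc : c ≠ 0)
    (hsq : ∀ s ∈ wordRoot w, ∀ t ∈ wordRoot w, t.2.1 ≠ s.1)
    (hj : ((wordRoot w).filter fun t => t.2.1 = j) = [(a, j, c)]) {x : Fin 27 → ℂ}
    (hx : x a ≠ 0) :
    ∃ y : Fin 27 → ℂ, y j = 0 ∧
      (∀ k, (∀ t ∈ wordRoot w, t.2.1 = k → x t.1 = 0) → y k = x k) ∧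
      ∀ q, IsSingular q → eval y q = eval x q := by
  have hc' : (c : ℂ) ≠ 0 := Int.cast_ne_zero.mpr hc
  refine ⟨fun k => x k + (-(x j / (c * x a))) * eval x (linDer (wordRoot w) (X k)), ?_, ?_,
    fun q hq => eval_flow_eq hsq (hq.wordRoot w) x _⟩
  · dsimp only
    rw [linDer_X_eq_linDer_filter, hj]
    simp only [linDer_cons_X, linDer_nil]
    simp only [if_true, Derivation.zero_apply, add_zero, smul_eval, eval_X]
    field_simp
    ring
  · intro k hk
    have h : ∀ L : List (Fin 27 × Fin 27 × ℤ), (∀ t ∈ L, t.2.1 = k → x t.1 = 0) →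
        eval x (linDer L (X k)) = 0 := fun L hL => by
      induction L with
      | nil => simp [linDer_nil]
      | cons t L ih =>
        rw [linDer_cons_X, map_add, ih fun s hs => hL s (List.mem_cons_of_mem _ hs)]
        split_ifs with ht
        · simp [smul_eval, hL t List.mem_cons_self ht]
        · simp
    dsimp only
    rw [h _ hk, mul_zero, add_zero]

lemma spinWord_spec : ∀ j ∈ spinIndices,
    (∃ c ∈ ([1, -1] : List ℤ),
      ((wordRoot (spinWord j)).filter fun t => t.2.1 = j) = [(0, j, c)]) ∧
    (∀ s ∈ wordRoot (spinWord j), ∀ t ∈ wordRoot (spinWord j), t.2.1 ≠ s.1) ∧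
    ∀ t ∈ wordRoot (spinWord j), t.2.1 ≠ 0 ∧ (t.2.1 = j ∨ t.2.1 ∉ spinIndices) := by
  decide +kernel

lemma vectorWord_spec : ∀ j ∈ vectorIndices,
    (∃ c ∈ ([1, -1] : List ℤ),
      ((wordRoot (vectorWord j)).filter fun t => t.2.1 = j) = [(13, j, c)]) ∧
    (∀ s ∈ wordRoot (vectorWord j), ∀ t ∈ wordRoot (vectorWord j), t.2.1 ≠ s.1) ∧
    ∀ t ∈ wordRoot (vectorWord j),
      t.2.1 = j ∨ t.2.1 = 26 ∨ (t.2.1 ∈ spinIndices ∧ t.1 ∈ spinIndices) := by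
  decide +kernel

lemma exists_spin_eq_zero {x : Fin 27 → ℂ} (hx : x 0 ≠ 0) :
    ∃ y : Fin 27 → ℂ, y 0 = x 0 ∧ (∀ k ∈ spinIndices, y k = 0) ∧
      ∀ q, IsSingular q → eval y q = eval x q := by
  suffices h : ∀ S ⊆ spinIndices, ∃ y : Fin 27 → ℂ, y 0 = x 0 ∧ (∀ k ∈ S, y k = 0) ∧
      ∀ q, IsSingular q → eval y q = eval x q from h _ subset_rfl
  intro S
  induction S using Finset.induction_on with
  | empty => exact fun _ => ⟨x, rfl, by simp, fun _ _ => rfl⟩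
  | insert j S hjS ih =>
    intro hS
    obtain ⟨y, hy0, hyS, hyq⟩ := ih ((Finset.subset_insert j S).trans hS)
    obtain ⟨⟨c, hc, hf⟩, hsq, ht⟩ := spinWord_spec j (hS (Finset.mem_insert_self j S))
    obtain ⟨z, hzj, hz, hzq⟩ := exists_eval_eq_of_root (x := y) (by rintro rfl; simp at hc) hsq hf
      (hy0 ▸ hx)
    refine ⟨z, ?_, ?_, fun q hq => (hzq q hq).trans (hyq q hq)⟩
    · rw [hz 0 fun t h h0 => absurd h0 (ht t h).1, hy0]
    · intro k hk
      rcases Finset.mem_insert.mp hk with rfl | hk'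
      · exact hzj
      · rw [hz k fun t h h0 => ?_, hyS k hk']
        rcases (ht t h).2 with h1 | h1
        · exact absurd (h1 ▸ h0 ▸ hk') hjS
        · exact absurd (h0 ▸ hS hk) h1

lemma exists_vector_eq_zero {x : Fin 27 → ℂ} (hx : x 13 ≠ 0) (hs : ∀ k ∈ spinIndices, x k = 0) :
    ∃ y : Fin 27 → ℂ, (∀ k ∈ spinIndices, y k = 0) ∧ (∀ k ∈ vectorIndices, y k = 0) ∧
      ∀ q, IsSingular q → eval y q = eval x q := by
  suffices h : ∀ S ⊆ vectorIndices, ∃ y : Fin 27 → ℂ, y 13 = x 13 ∧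
      (∀ k ∈ spinIndices, y k = 0) ∧ (∀ k ∈ S, y k = 0) ∧
      ∀ q, IsSingular q → eval y q = eval x q by
    obtain ⟨y, -, h⟩ := h _ subset_rfl
    exact ⟨y, h⟩
  have hdisj : ∀ j ∈ vectorIndices, j ≠ 13 ∧ j ≠ 26 ∧ j ∉ spinIndices := by decide
  have h13 : (13 : Fin 27) ∉ spinIndices := by decide
  intro S
  induction S using Finset.induction_on with
  | empty => exact fun _ => ⟨x, rfl, hs, by simp, fun _ _ => rfl⟩
  | insert j S hjS ih =>
    intro hS
    have hj := hS (Finset.mem_insert_self j S)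
    obtain ⟨y, hy0, hys, hyS, hyq⟩ := ih ((Finset.subset_insert j S).trans hS)
    obtain ⟨⟨c, hc, hf⟩, hsq, ht⟩ := vectorWord_spec j hj
    obtain ⟨z, hzj, hz, hzq⟩ := exists_eval_eq_of_root (x := y) (by rintro rfl; simp at hc) hsq hf
      (hy0 ▸ hx)
    have key : ∀ k, k ≠ j → k ≠ 26 → z k = y k := fun k hkj hk => hz k fun t h h0 => by
      rcases ht t h with h1 | h1 | h1
      · exact absurd (h0.symm.trans h1) hkj
      · exact absurd (h0.symm.trans h1) hk
      · exact hys _ h1.2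
    refine ⟨z, ?_, ?_, ?_, fun q hq => (hzq q hq).trans (hyq q hq)⟩
    · rw [key 13 (hdisj j hj).1.symm (by decide), hy0]
    · intro k hk
      rw [key k (by rintro rfl; exact (hdisj k hj).2.2 hk) (by rintro rfl; revert hk; decide),
        hys k hk]
    · intro k hk
      rcases Finset.mem_insert.mp hk with rfl | hk'
      · exact hzj
      · rw [key k (by rintro rfl; exact hjS hk') (hdisj k (hS hk)).2.1, hyS k hk']

/-- The point with coordinates `a, b, c` in three pairwise orthogonal weight directions. -/
def slicePoint (a b c : ℂ) : Fin 27 → ℂ := fun k =>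
  if k = 0 then a else if k = 13 then b else if k = 26 then c else 0

lemma isSingular_cubicForm : IsSingular cubicForm := linDer_simpleRoot_cubicForm

lemma eval_slicePoint_zeta_one (a b c : ℂ) : eval (slicePoint a b c) (zeta 1) = a * b := by
  simp [zeta_one, slicePoint]

lemma eval_slicePoint_cubicForm (a b c : ℂ) :
    eval (slicePoint a b c) cubicForm = a * b * c := by
  simp [cubicForm, slicePoint]

/-- Generic points can be moved to the slice without changing the values of singular
polynomials. -/
lemma IsSingular.eval_eq_eval_slicePoint {q : A} (hq : IsSingular q) {x : Fin 27 → ℂ}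
    (hx : x 0 ≠ 0) (hz : eval x (zeta 1) ≠ 0) :
    eval x q = eval (slicePoint (x 0) (eval x (zeta 1) / x 0)
      (eval x cubicForm / eval x (zeta 1))) q := by
  obtain ⟨y, hy0, hys, hyq⟩ := exists_spin_eq_zero hx
  have hyz : eval y (zeta 1) = y 0 * y 13 := by
    have h : ∀ k ∈ ({1, 2, 3, 4} : Finset (Fin 27)), y k = 0 := fun k hk =>
      hys k ((by decide : ({1, 2, 3, 4} : Finset (Fin 27)) ⊆ spinIndices) hk)
    simp [zeta_one, h 1, h 2, h 3, h 4]
  have hy13 : y 13 ≠ 0 := fun h => hz (by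
    rw [← hyq _ isSingular_zeta_one, hyz, h, mul_zero])
  obtain ⟨z, hzs, hzv, hzq⟩ := exists_vector_eq_zero hy13 hys
  have hcover : ∀ k : Fin 27, k = 0 ∨ k = 13 ∨ k = 26 ∨ k ∈ spinIndices ∨ k ∈ vectorIndices := by
    decide
  have hslice : z = slicePoint (z 0) (z 13) (z 26) := by
    funext k
    simp only [slicePoint]
    split_ifs with h0 h1 h2
    · rw [h0]
    · rw [h1]
    · rw [h2]
    · rcases hcover k with h | h | h | h | h
      · exact absurd h h0
      · exact absurd h h1
      · exact absurd h h2
      · exact hzs k h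
      · exact hzv k h
  have hval : ∀ p, IsSingular p → eval (slicePoint (z 0) (z 13) (z 26)) p = eval x p :=
    fun p hp => hslice ▸ (hzq p hp).trans (hyq p hp)
  have h1 : z 0 = x 0 := by simpa [slicePoint] using hval _ isSingular_X_zero
  have h2 := hval _ isSingular_zeta_one
  have h3 := hval _ isSingular_cubicForm
  rw [eval_slicePoint_zeta_one] at h2
  rw [eval_slicePoint_cubicForm, h2] at h3
  have h4 : eval x (zeta 1) / x 0 = z 13 := by rw [← h2, h1, mul_div_cancel_left₀ _ hx]
  have h5 : eval x cubicForm / eval x (zeta 1) = z 26 := by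
    rw [← h3, mul_div_cancel_left₀ _ hz]
  rw [h4, h5, ← h1, hval q hq]

/-- The fundamental singular polynomials. -/
def fundamentalSingular : Fin 3 → A := ![X 0, zeta 1, cubicForm]

/-- A polynomial section of the map to affine 3-space given by `fundamentalSingular`. -/
def singularSection : Fin 27 → MvPolynomial (Fin 3) ℂ := fun k =>
  if k = 0 then X 0 else if k = 10 then X 1 else if k = 25 then X 2 else
    if k = 1 ∨ k = 14 then 1 else 0

lemma eval_aeval {σ τ : Type*} (g : σ → MvPolynomial τ ℂ) (x : τ → ℂ) (r : MvPolynomial σ ℂ) :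
    eval x (aeval g r) = eval (fun i => eval x (g i)) r := by
  induction r using MvPolynomial.induction_on with
  | C a => simp
  | add a b ha hb => rw [map_add, map_add, map_add, ha, hb]
  | mul_X a i ha => rw [map_mul, map_mul, map_mul, ha, aeval_X, eval_X]

/-- Singular polynomials are polynomials in `x_1`, `ζ_1` and the invariant cubic form. -/
theorem IsSingular.exists_eq_aeval {p : A} (hp : IsSingular p) :
    ∃ r : MvPolynomial (Fin 3) ℂ, p = aeval fundamentalSingular r := by
  refine ⟨aeval singularSection p, ?_⟩
  have hX : (X 0 : A) ≠ 0 := X_ne_zero 0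
  have hZ : zeta 1 ≠ 0 := fun h => by
    simpa [eval_slicePoint_zeta_one] using congrArg (eval (slicePoint 1 1 1)) h
  rw [← sub_eq_zero]
  refine (mul_eq_zero.mp ?_).resolve_right (mul_ne_zero hX hZ)
  refine MvPolynomial.funext fun x => ?_
  rw [map_zero, map_mul, map_mul, eval_X]
  by_cases hx : x 0 = 0
  · simp [hx]
  by_cases hz : eval x (zeta 1) = 0
  · simp [hz]
  rw [map_sub]
  refine mul_eq_zero_of_left (sub_eq_zero.mpr ?_) _
  set u : Fin 3 → ℂ := fun i => eval x (fundamentalSingular i) with hu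
  set y : Fin 27 → ℂ := fun k => eval u (singularSection k) with hy
  have hr : eval x (aeval fundamentalSingular (aeval singularSection p)) = eval y p := by
    rw [eval_aeval, eval_aeval]
  have hy0 : y 0 = x 0 := by simp [hy, hu, singularSection, fundamentalSingular]
  have hyZ : eval y (zeta 1) = eval x (zeta 1) := by
    conv_lhs => rw [zeta_one]
    simp [hy, hu, singularSection, fundamentalSingular]
  have hyC : eval y cubicForm = eval x cubicForm := by
    conv_lhs => rw [cubicForm]
    simp [hy, hu, singularSection, fundamentalSingular]
  rw [hr, hp.eval_eq_eval_slicePoint hx hz,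
    hp.eval_eq_eval_slicePoint (x := y) (by rwa [hy0]) (by rwa [hyZ]), hy0, hyZ, hyC]

/-! ### Orthogonal decompositions -/

section Orthogonal

variable {σ : Type*}

/-- The orthogonal complement of a subspace for the Fischer inner product. -/
def fischerCompl (W : Submodule ℂ (MvPolynomial σ ℂ)) : Submodule ℂ (MvPolynomial σ ℂ) where
  carrier := {p | ∀ q ∈ W, fischer p q = 0}
  add_mem' ha hb q hq := by rw [fischer_add_left, ha q hq, hb q hq, add_zero]
  zero_mem' q _ := by simp [fischer]
  smul_mem' c p hp q hq := by rw [fischer_smul_left, hp q hq, mul_zero]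

lemma mem_fischerCompl {W : Submodule ℂ (MvPolynomial σ ℂ)} {p : MvPolynomial σ ℂ} :
    p ∈ fischerCompl W ↔ ∀ q ∈ W, fischer p q = 0 := Iff.rfl

lemma fischer_eq_zero_comm {p q : MvPolynomial σ ℂ} : fischer p q = 0 ↔ fischer q p = 0 := by
  rw [← fischer_star, star_eq_zero]

lemma fischer_self_eq_zero {p : MvPolynomial σ ℂ} (h : fischer p p = 0) : p = 0 :=
  (fischerCore σ).definite p h

lemma exists_sub_mem_fischerCompl (W : Submodule ℂ (MvPolynomial σ ℂ)) [FiniteDimensional ℂ W]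
    (p : MvPolynomial σ ℂ) : ∃ q ∈ W, p - q ∈ fischerCompl W := by
  let : InnerProductSpace.Core ℂ (MvPolynomial σ ℂ) := fischerCore σ
  let : NormedAddCommGroup (MvPolynomial σ ℂ) :=
    InnerProductSpace.Core.toNormedAddCommGroup (𝕜 := ℂ)
  let : InnerProductSpace ℂ (MvPolynomial σ ℂ) := InnerProductSpace.ofCore _
  obtain ⟨y, hy, z, hz, h⟩ := W.exists_add_mem_mem_orthogonal p
  refine ⟨y, hy, fun q hq => ?_⟩
  rw [h, add_sub_cancel_left]
  exact fischer_eq_zero_comm.mp ((W.mem_orthogonal z).mp hz q hq)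

lemma finrank_sup_of_fischer_orthogonal {ι : Type*} (T : Finset ι)
    (M : ι → Submodule ℂ (MvPolynomial σ ℂ)) [∀ i, FiniteDimensional ℂ (M i)]
    (h : ∀ i ∈ T, ∀ j ∈ T, i ≠ j → M i ≤ fischerCompl (M j)) :
    Module.finrank ℂ (T.sup M : Submodule ℂ (MvPolynomial σ ℂ)) =
      ∑ i ∈ T, Module.finrank ℂ (M i) := by
  classical
  induction T using Finset.induction_on with
  | empty => simp
  | insert a T ha ih =>
    have hle : T.sup M ≤ fischerCompl (M a) := Finset.sup_le fun i hi =>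
      h i (Finset.mem_insert_of_mem hi) a (Finset.mem_insert_self a T) fun hia => ha (hia ▸ hi)
    have hbot : M a ⊓ T.sup M = ⊥ := (Submodule.eq_bot_iff _).mpr fun p hp =>
      fischer_self_eq_zero (hle (Submodule.mem_inf.mp hp).2 p (Submodule.mem_inf.mp hp).1)
    have hsum := Submodule.finrank_sup_add_finrank_inf_eq (M a) (T.sup M)
    rw [hbot, finrank_bot, add_zero] at hsum
    rw [Finset.sup_insert, Finset.sum_insert ha, hsum, ih fun i hi j hj =>
      h i (Finset.mem_insert_of_mem hi) j (Finset.mem_insert_of_mem hj)]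

end Orthogonal

/-! ### Cyclic submodules -/

/-- Invariance under all simple root vectors. -/
def IsRootInvariant (W : Submodule ℂ A) : Prop :=
  ∀ i, ∀ p ∈ W, linDer (simpleRoot i) p ∈ W ∧ linDer (negTranspose (simpleRoot i)) p ∈ W

/-- The smallest submodule containing a given polynomial. -/
def cyclic (v : A) : Submodule ℂ A := sInf {W | v ∈ W ∧ IsRootInvariant W}

lemma Lmod_eq_cyclic (m n : ℕ) : Lmod m n = cyclic (X 0 ^ m * zeta 1 ^ n) := by
  refine congrArg sInf (Set.ext fun W => ?_)
  have hx : xv 1 = X 0 := rfl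
  refine and_congr (by rw [hx]) ⟨fun h i p hp => ?_, fun h i h1 h6 p hp => ?_⟩
  · rw [← eOp_eq, ← fOp_eq]
    exact h _ (by omega) (by omega) p hp
  · obtain ⟨j, rfl⟩ : ∃ j : Fin 6, i = j + 1 := ⟨⟨i - 1, by omega⟩, by simp; omega⟩
    rw [eOp_eq, fOp_eq]
    exact h j p hp

lemma mem_cyclic (v : A) : v ∈ cyclic v := Submodule.mem_sInf.mpr fun _ hW => hW.1

lemma cyclic_le {v : A} {W : Submodule ℂ A} (hv : v ∈ W) (hW : IsRootInvariant W) : cyclic v ≤ W :=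
  sInf_le ⟨hv, hW⟩

lemma isRootInvariant_cyclic (v : A) : IsRootInvariant (cyclic v) := fun i p hp => by
  simp only [cyclic, Submodule.mem_sInf] at hp ⊢
  exact ⟨fun W hW => (hW.2 i p (hp W hW)).1, fun W hW => (hW.2 i p (hp W hW)).2⟩

lemma IsRootInvariant.inf {V W : Submodule ℂ A} (hV : IsRootInvariant V) (hW : IsRootInvariant W) :
    IsRootInvariant (V ⊓ W) := fun i p hp =>
  ⟨⟨(hV i p hp.1).1, (hW i p hp.2).1⟩, ⟨(hV i p hp.1).2, (hW i p hp.2).2⟩⟩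

lemma isRootInvariant_homogeneousSubmodule (m : ℕ) :
    IsRootInvariant (homogeneousSubmodule (Fin 27) ℂ m) :=
  fun _ _ hp => ⟨linDer_isHomogeneous _ hp, linDer_isHomogeneous _ hp⟩

lemma negTranspose_negTranspose {σ : Type*} (L : List (σ × σ × ℤ)) :
    negTranspose (negTranspose L) = L := by
  simp [negTranspose, Function.comp_def]

lemma IsRootInvariant.fischerCompl {W : Submodule ℂ A} (hW : IsRootInvariant W) :
    IsRootInvariant (fischerCompl W) := fun i p hp => by
  refine ⟨fun q hq => ?_, fun q hq => ?_⟩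
  · rw [fischer_linDer_left, hp _ (hW i q hq).2, neg_zero]
  · rw [fischer_linDer_left, negTranspose_negTranspose, hp _ (hW i q hq).1, neg_zero]

lemma linDer_mul_cubicForm_pow {L : List (Fin 27 × Fin 27 × ℤ)} (hL : linDer L cubicForm = 0)
    (k : ℕ) (p : A) : linDer L (cubicForm ^ k * p) = cubicForm ^ k * linDer L p := by
  rw [Derivation.leibniz, Derivation.leibniz_pow, hL]
  simp

lemma cyclic_cubicForm_pow_mul (k : ℕ) (v : A) :
    cyclic (cubicForm ^ k * v) = (cyclic v).map (LinearMap.mulLeft ℂ (cubicForm ^ k)) := by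
  have hE := fun i => linDer_mul_cubicForm_pow (linDer_simpleRoot_cubicForm i) k
  have hF := fun i => linDer_mul_cubicForm_pow (linDer_negTranspose_cubicForm i) k
  refine le_antisymm (cyclic_le ⟨v, mem_cyclic v, rfl⟩ ?_)
    (Submodule.map_le_iff_le_comap.mpr (cyclic_le (mem_cyclic _) ?_))
  · rintro i _ ⟨p, hp, rfl⟩
    exact ⟨⟨_, (isRootInvariant_cyclic v i p hp).1, (hE i p).symm⟩,
      ⟨_, (isRootInvariant_cyclic v i p hp).2, (hF i p).symm⟩⟩
  · intro i p hp
    have h := isRootInvariant_cyclic _ i _ hp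
    simp only [LinearMap.mulLeft_apply, hE, hF] at h
    exact h

/-! ### Weights -/

/-- The simple coroots of `E₆`, up to sign. -/
def cartan (i : Fin 6) : List (Fin 27 × Fin 27 × ℤ) :=
  bracketList (simpleRoot i) (negTranspose (simpleRoot i))

/-- The weights of the 27-dimensional representation. -/
def weight (i : Fin 6) (k : Fin 27) : ℤ :=
  ((cartan i).map fun t => if t.2.1 = k then t.2.2 else 0).sum

lemma linDer_X_of_diagonal {σ : Type*} [DecidableEq σ] {H : List (σ × σ × ℤ)}
    (h : ∀ t ∈ H, t.1 = t.2.1) (k : σ) :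
    linDer H (X k) =
      ((H.map fun t => if t.2.1 = k then t.2.2 else 0).sum : ℤ) • (X k : MvPolynomial σ ℂ) := by
  induction H with
  | nil => simp [linDer_nil]
  | cons t H ih =>
    rw [linDer_cons_X, ih fun s hs => h s (List.mem_cons_of_mem _ hs), h t List.mem_cons_self]
    by_cases hk : t.2.1 = k <;> simp [hk, add_smul, Int.cast_smul_eq_zsmul]

lemma linDer_cartan_X (i : Fin 6) (k : Fin 27) :
    linDer (cartan i) (X k) = (weight i k : ℂ) • (X k : A) := by
  have h : ∀ i, ∀ t ∈ cartan i, t.1 = t.2.1 := by decide +kernel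
  rw [linDer_X_of_diagonal (h i), Int.cast_smul_eq_zsmul, weight]

lemma exists_linDer_cartan_commutator (i j : Fin 6) : ∃ n : ℤ, ∀ p : A,
    linDer (cartan i) (linDer (simpleRoot j) p) - linDer (simpleRoot j) (linDer (cartan i) p) =
      (n : ℂ) • linDer (simpleRoot j) p := by
  have h : ∀ i j, ∃ n ∈ Finset.Icc (-2 : ℤ) 2,
      ∀ t ∈ simpleRoot j, weight i t.1 - weight i t.2.1 = n := by decide +kernel
  obtain ⟨n, -, hn⟩ := h i j
  exact ⟨n, linDer_commutator_of_diagonal (linDer_cartan_X i) hn⟩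

lemma linDer_simpleRoot_commute {i j : Fin 6} (hij : i ≠ j) (p : A) :
    linDer (simpleRoot i) (linDer (negTranspose (simpleRoot j)) p) =
      linDer (negTranspose (simpleRoot j)) (linDer (simpleRoot i) p) := by
  have h : ∀ i j, i ≠ j → (bracketList (simpleRoot i) (negTranspose (simpleRoot j))).Perm
      ((bracketList (simpleRoot i) (negTranspose (simpleRoot j))).map
        fun t => (t.1, t.2.1, -t.2.2)) := by decide +kernel
  rw [← sub_eq_zero, linDer_commutator, linDer_eq_zero_of_perm_neg (h i j hij),
    Derivation.zero_apply]

/-- A cyclic submodule generated by a singular vector is already generated by it under the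
negative root vectors and the Cartan subalgebra. -/
lemma IsSingular.cyclic_le {v : A} (hv : IsSingular v) {W : Submodule ℂ A} (hvW : v ∈ W)
    (hF : ∀ i, ∀ p ∈ W, linDer (negTranspose (simpleRoot i)) p ∈ W)
    (hH : ∀ i, ∀ p ∈ W, linDer (cartan i) p ∈ W) : cyclic v ≤ W := by
  set S : Set (Submodule ℂ A) := {V | v ∈ V ∧ ∀ i, ∀ p ∈ V,
    linDer (negTranspose (simpleRoot i)) p ∈ V ∧ linDer (cartan i) p ∈ V} with hS
  have hvV : v ∈ sInf S := Submodule.mem_sInf.mpr fun V hV => hV.1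
  have hFV : ∀ i, ∀ p ∈ sInf S, linDer (negTranspose (simpleRoot i)) p ∈ sInf S :=
    fun i p hp => Submodule.mem_sInf.mpr fun V hV => (hV.2 i p (Submodule.mem_sInf.mp hp V hV)).1
  have hHV : ∀ i, ∀ p ∈ sInf S, linDer (cartan i) p ∈ sInf S :=
    fun i p hp => Submodule.mem_sInf.mpr fun V hV => (hV.2 i p (Submodule.mem_sInf.mp hp V hV)).2
  have hE : sInf S ≤ sInf S ⊓ ⨅ i, (sInf S).comap (linDer (simpleRoot i)).toLinearMap := by
    refine sInf_le ⟨⟨hvV, ?_⟩, fun i p hp => ?_⟩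
    · refine Submodule.mem_iInf _ |>.mpr fun i => ?_
      change linDer (simpleRoot i) v ∈ sInf S
      rw [hv i]
      exact zero_mem _
    · obtain ⟨hp, hp'⟩ := hp
      have hp' : ∀ j, linDer (simpleRoot j) p ∈ sInf S := fun j => (Submodule.mem_iInf _).mp hp' j
      refine ⟨⟨hFV i p hp, (Submodule.mem_iInf _).mpr fun j => ?_⟩,
        ⟨hHV i p hp, (Submodule.mem_iInf _).mpr fun j => ?_⟩⟩
      · change linDer (simpleRoot j) (linDer (negTranspose (simpleRoot i)) p) ∈ sInf S
        by_cases hij : j = i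
        · subst hij
          rw [← sub_add_cancel (linDer (simpleRoot j) _)
            (linDer (negTranspose (simpleRoot j)) (linDer (simpleRoot j) p)), linDer_commutator]
          exact add_mem (hHV j p hp) (hFV j _ (hp' j))
        · rw [linDer_simpleRoot_commute hij]
          exact hFV i _ (hp' j)
      · change linDer (simpleRoot j) (linDer (cartan i) p) ∈ sInf S
        obtain ⟨n, hn⟩ := exists_linDer_cartan_commutator i j
        rw [← sub_sub_cancel (linDer (cartan i) (linDer (simpleRoot j) p))
          (linDer (simpleRoot j) (linDer (cartan i) p)), hn]
        exact sub_mem (hHV i _ (hp' j)) (Submodule.smul_mem _ _ (hp' j))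
  refine (_root_.cyclic_le hvV fun i p hp => ⟨?_, hFV i p hp⟩).trans
    (sInf_le ⟨hvW, fun i p hp => ⟨hF i p hp, hH i p hp⟩⟩)
  exact (Submodule.mem_iInf _).mp (hE hp).2 i

lemma fischer_linDer_cartan (i : Fin 6) (p q : A) :
    fischer (linDer (cartan i) p) q = fischer p (linDer (cartan i) q) := by
  have hsub : ∀ a b c : A, fischer (a - b) c = fischer a c - fischer b c := fun a b c => by
    rw [eq_sub_iff_add_eq, ← fischer_add_left, sub_add_cancel]
  have hsub' : ∀ a b c : A, fischer a (b - c) = fischer a b - fischer a c := fun a b c => by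
    rw [← fischer_star, hsub, star_sub, fischer_star, fischer_star]
  rw [cartan, ← linDer_commutator, ← linDer_commutator, hsub, hsub']
  simp only [fischer_linDer_left, negTranspose_negTranspose, neg_neg]

/-- Cyclic submodules generated by singular vectors of distinct weights are orthogonal. -/
lemma IsSingular.cyclic_le_fischerCompl {u v : A} (hu : IsSingular u) (hv : IsSingular v)
    {a b : Fin 6 → ℤ} (ha : ∀ i, linDer (cartan i) u = (a i : ℂ) • u)
    (hb : ∀ i, linDer (cartan i) v = (b i : ℂ) • v) (hab : a ≠ b) :
    cyclic u ≤ fischerCompl (cyclic v) := by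
  obtain ⟨i, hi⟩ := Function.ne_iff.mp hab
  have hright : ∀ (c : ℂ) (p q : A), fischer p (c • q) = c * fischer p q := fun c p q => by
    simp [fischer, Finset.mul_sum, mul_left_comm]
  have huv : fischer u v = 0 := by
    have h := fischer_linDer_cartan i u v
    rw [ha, hb, fischer_smul_left, hright, star_intCast] at h
    exact (mul_eq_mul_right_iff.mp h).resolve_left fun h => hi (Int.cast_injective h)
  refine _root_.cyclic_le (fun q hq => ?_) (isRootInvariant_cyclic v).fischerCompl
  have hle : cyclic v ≤ fischerCompl (Submodule.span ℂ {u}) := by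
    refine hv.cyclic_le ?_ ?_ ?_
    all_goals simp only [mem_fischerCompl, Submodule.mem_span_singleton, forall_exists_index,
      forall_apply_eq_imp_iff, hright, mul_eq_zero]
    · exact fun c => Or.inr (fischer_eq_zero_comm.mp huv)
    · intro i p _ c
      rw [fischer_linDer_left, negTranspose_negTranspose, hu i]
      simp [fischer]
    · intro i p hp c
      rw [fischer_linDer_cartan, ha, hright, (hp 1).resolve_left one_ne_zero, mul_zero]
      exact Or.inr rfl
  exact fischer_eq_zero_comm.mp (hle hq u (Submodule.mem_span_singleton_self u))

/-! ### Existence of singular vectors -/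

/-- The height of a weight of the 27-dimensional representation below the highest one. -/
def height : Fin 27 → ℕ :=
  ![0, 1, 2, 3, 4, 4, 5, 5, 6, 6, 7, 7, 8, 8, 8, 9, 9, 10, 10, 11, 11, 12, 12, 13, 14, 15, 16]

lemma coeff_linDer_eq_zero {σ : Type*} [DecidableEq σ] {L : List (σ × σ × ℤ)} {ht : σ → ℕ}
    (hL : ∀ t ∈ L, ht t.2.1 = ht t.1 + 1) {p : MvPolynomial σ ℂ} {n : ℕ}
    (hp : ∀ d, n < Finsupp.weight ht d → coeff d p = 0) (d : σ →₀ ℕ)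
    (hd : n ≤ Finsupp.weight ht d) : coeff d (linDer L p) = 0 := by
  induction L with
  | nil => simp [linDer_nil]
  | cons t L ih =>
    rw [linDer_cons, Derivation.add_apply, coeff_add,
      ih fun s hs => hL s (List.mem_cons_of_mem _ hs), add_zero, Derivation.smul_apply,
      Derivation.smul_apply, coeff_smul, smul_eq_mul (α := MvPolynomial σ ℂ), coeff_X_mul']
    split_ifs with h
    · have hle : Finsupp.single t.1 1 ≤ d := by
        simpa [Nat.one_le_iff_ne_zero] using h
      have hw := congrArg (Finsupp.weight ht) (tsub_add_cancel_of_le hle)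
      rw [map_add, Finsupp.weight_single, one_smul] at hw
      rw [coeff_pderiv, hp, zero_mul, smul_zero]
      rw [map_add, Finsupp.weight_single, one_smul, hL t List.mem_cons_self]
      omega
    · exact smul_zero _

lemma exists_isSingular_of_ne_bot {W : Submodule ℂ A}
    (hW : ∀ i, ∀ p ∈ W, linDer (simpleRoot i) p ∈ W) {p : A} (hp : p ∈ W) (hp0 : p ≠ 0) :
    ∃ u ∈ W, u ≠ 0 ∧ IsSingular u := by
  have hroot : ∀ i, ∀ t ∈ simpleRoot i, height t.2.1 = height t.1 + 1 := by decide
  suffices h : ∀ n : ℕ, ∀ p ∈ W, p ≠ 0 →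
      (∀ d, n ≤ Finsupp.weight height d → coeff d p = 0) → ∃ u ∈ W, u ≠ 0 ∧ IsSingular u by
    refine h (p.support.sup (Finsupp.weight height) + 1) p hp hp0 fun d hd => ?_
    by_contra hdp
    have := Finset.le_sup (f := Finsupp.weight height) (mem_support_iff.mpr hdp)
    omega
  intro n
  induction n with
  | zero => exact fun p _ hp0 hd => absurd (MvPolynomial.ext _ _ fun d => hd d (Nat.zero_le _)) hp0
  | succ n ih =>
    intro p hp hp0 hd
    by_cases hs : IsSingular p
    · exact ⟨p, hp, hp0, hs⟩
    · obtain ⟨i, hi⟩ := not_forall.mp hs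
      exact ih _ (hW i p hp) hi (coeff_linDer_eq_zero (hroot i) hd)

/-! ### Singular monomials -/

/-- The monomial in the fundamental singular polynomials with given exponents. -/
def singularMonomial (t : ℕ × ℕ × ℕ) : A := cubicForm ^ t.2.2 * (X 0 ^ t.1 * zeta 1 ^ t.2.1)

lemma isSingular_singularMonomial (t : ℕ × ℕ × ℕ) : IsSingular (singularMonomial t) := fun i => by
  rw [singularMonomial, linDer_mul_cubicForm_pow (linDer_simpleRoot_cubicForm i)]
  simp [Derivation.leibniz, Derivation.leibniz_pow, isSingular_X_zero i, isSingular_zeta_one i]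

lemma zeta_one_isHomogeneous : (zeta 1).IsHomogeneous 2 := by
  rw [zeta_one]
  repeat' with_reducible_and_instances first | apply IsHomogeneous.add | apply IsHomogeneous.sub
  all_goals exact (isHomogeneous_X ℂ _).mul (isHomogeneous_X ℂ _)

lemma cubicForm_isHomogeneous : cubicForm.IsHomogeneous 3 := by
  rw [cubicForm]
  repeat' with_reducible_and_instances first | apply IsHomogeneous.add | apply IsHomogeneous.sub
  all_goals exact ((isHomogeneous_X ℂ _).mul (isHomogeneous_X ℂ _)).mul (isHomogeneous_X ℂ _)

lemma X_pow_mul_zeta_one_pow_isHomogeneous (m n : ℕ) :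
    (X 0 ^ m * zeta 1 ^ n : A).IsHomogeneous (m + 2 * n) := by
  simpa using (isHomogeneous_X_pow (R := ℂ) (0 : Fin 27) m).mul (zeta_one_isHomogeneous.pow n)

lemma singularMonomial_isHomogeneous (t : ℕ × ℕ × ℕ) :
    (singularMonomial t).IsHomogeneous (t.1 + 2 * t.2.1 + 3 * t.2.2) := by
  rw [add_comm]
  exact (cubicForm_isHomogeneous.pow _).mul (X_pow_mul_zeta_one_pow_isHomogeneous _ _)

lemma linDer_cartan_singularMonomial (i : Fin 6) (t : ℕ × ℕ × ℕ) :
    linDer (cartan i) (singularMonomial t) =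
      ((t.1 * weight i 0 + t.2.1 * (weight i 0 + weight i 13) : ℤ) : ℂ) • singularMonomial t := by
  have hw : ∀ i, weight i 1 + weight i 10 = weight i 0 + weight i 13 ∧
      weight i 2 + weight i 8 = weight i 0 + weight i 13 ∧
      weight i 3 + weight i 6 = weight i 0 + weight i 13 ∧
      weight i 4 + weight i 5 = weight i 0 + weight i 13 := by decide +kernel
  have hmul : ∀ (a b : Fin 27) {c : ℤ}, weight i a + weight i b = c →
      linDer (cartan i) (X a * X b) = (c : ℂ) • (X a * X b : A) := by
    rintro a b _ rfl
    rw [Derivation.leibniz, linDer_cartan_X, linDer_cartan_X]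
    simp only [smul_eq_mul, smul_eq_C_mul, Int.cast_add, map_add]
    ring
  obtain ⟨h1, h2, h3, h4⟩ := hw i
  have hz : linDer (cartan i) (zeta 1) = ((weight i 0 + weight i 13 : ℤ) : ℂ) • zeta 1 := by
    rw [zeta_one]
    simp only [map_add, map_sub, hmul 0 13 rfl, hmul _ _ h1, hmul _ _ h2, hmul _ _ h3, hmul _ _ h4,
      smul_add, smul_sub]
  have hpow : ∀ {p : A} {c : ℂ} (n : ℕ), linDer (cartan i) p = c • p →
      linDer (cartan i) (p ^ n) = (n * c) • p ^ n := by
    intro p c n hp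
    rw [Derivation.leibniz_pow, hp]
    rcases n with _ | n
    · simp
    · simp only [Nat.add_sub_cancel, smul_eq_mul, smul_eq_C_mul, nsmul_eq_mul, map_mul,
        map_natCast]
      ring
  have hc : linDer (cartan i) cubicForm = 0 := by
    rw [cartan, ← linDer_commutator, linDer_simpleRoot_cubicForm, linDer_negTranspose_cubicForm,
      map_zero, map_zero, sub_zero]
  rw [singularMonomial, linDer_mul_cubicForm_pow hc, Derivation.leibniz,
    hpow _ hz, hpow _ (linDer_cartan_X i 0)]
  simp only [smul_eq_mul, smul_eq_C_mul, Int.cast_add, Int.cast_mul, Int.cast_natCast, map_add,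
    map_mul, map_natCast]
  ring

/-- The exponents of the singular monomials of degree `m`. -/
def singularExponents (m : ℕ) : Finset (ℕ × ℕ × ℕ) :=
  (Finset.range (m + 1) ×ˢ Finset.range (m + 1) ×ˢ Finset.range (m + 1)).filter
    fun t => t.1 + 2 * t.2.1 + 3 * t.2.2 = m

lemma mem_singularExponents {m : ℕ} {t : ℕ × ℕ × ℕ} :
    t ∈ singularExponents m ↔ t.1 + 2 * t.2.1 + 3 * t.2.2 = m := by
  simp only [singularExponents, Finset.mem_filter, Finset.mem_product, Finset.mem_range]
  omega

lemma IsSingular.mem_of_isHomogeneous {u : A} (hu : IsSingular u) {m : ℕ} (hm : u.IsHomogeneous m)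
    {N : Submodule ℂ A} (hN : ∀ t ∈ singularExponents m, singularMonomial t ∈ N) : u ∈ N := by
  obtain ⟨r, rfl⟩ := hu.exists_eq_aeval
  suffices h : ∀ r : MvPolynomial (Fin 3) ℂ,
      homogeneousComponent m (aeval fundamentalSingular r) ∈ N by
    have hr := h r
    rwa [homogeneousComponent_of_mem hm, if_pos rfl] at hr
  intro r
  induction r using MvPolynomial.induction_on' with
  | monomial d c =>
    have hd : aeval fundamentalSingular (monomial d c) =
        c • singularMonomial (d 0, d 1, d 2) := by
      rw [aeval_monomial, Finsupp.prod_fintype _ _ (by simp), Fin.prod_univ_three, algebraMap_eq,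
        smul_eq_C_mul, singularMonomial]
      simp only [fundamentalSingular, Matrix.cons_val_zero, Matrix.cons_val_one, Matrix.cons_val]
      ring
    rw [hd, map_smul, homogeneousComponent_of_mem (singularMonomial_isHomogeneous _)]
    split_ifs with h
    · exact N.smul_mem _ (hN _ (mem_singularExponents.mpr h.symm))
    · simp
  | add p q hp hq =>
    rw [map_add, map_add]
    exact add_mem hp hq

lemma cyclic_singularMonomial_le_fischerCompl {m : ℕ} {s t : ℕ × ℕ × ℕ}
    (hs : s ∈ singularExponents m) (ht : t ∈ singularExponents m) (hst : s ≠ t) :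
    cyclic (singularMonomial s) ≤ fischerCompl (cyclic (singularMonomial t)) := by
  refine (isSingular_singularMonomial s).cyclic_le_fischerCompl (isSingular_singularMonomial t)
    (linDer_cartan_singularMonomial · s) (linDer_cartan_singularMonomial · t) fun h => hst ?_
  have hw : weight 0 0 ≠ 0 ∧ weight 0 0 + weight 0 13 = 0 ∧ weight 5 0 = 0 ∧ weight 5 13 ≠ 0 := by
    decide +kernel
  obtain ⟨h1, h2, h3, h4⟩ := hw
  have h0 := congrFun h 0
  have h5 := congrFun h 5
  simp only [h2, h3, mul_zero, add_zero, zero_add] at h0 h5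
  have e0 := Nat.cast_injective (R := ℤ) (mul_right_cancel₀ h1 h0)
  have e5 := Nat.cast_injective (R := ℤ) (mul_right_cancel₀ h4 h5)
  rw [mem_singularExponents] at hs ht
  refine Prod.ext e0 (Prod.ext e5 ?_)
  omega

instance (m : ℕ) : FiniteDimensional ℂ (homogeneousSubmodule (Fin 27) ℂ m) :=
  Module.Finite.iff_fg.mpr (homogeneousSubmodule_fg _ _ m)

lemma cyclic_le_homogeneousSubmodule {v : A} {m : ℕ} (hv : v.IsHomogeneous m) :
    cyclic v ≤ homogeneousSubmodule (Fin 27) ℂ m :=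
  cyclic_le hv (isRootInvariant_homogeneousSubmodule m)

instance (t : ℕ × ℕ × ℕ) : FiniteDimensional ℂ (cyclic (singularMonomial t)) :=
  Submodule.finiteDimensional_of_le
    (cyclic_le_homogeneousSubmodule (singularMonomial_isHomogeneous t))

lemma sup_cyclic_singularMonomial (m : ℕ) :
    (singularExponents m).sup (fun t => cyclic (singularMonomial t)) =
      homogeneousSubmodule (Fin 27) ℂ m := by
  set N := (singularExponents m).sup fun t => cyclic (singularMonomial t) with hN
  have hle : ∀ t ∈ singularExponents m, cyclic (singularMonomial t) ≤ N :=
    fun t ht => Finset.le_sup (f := fun t => cyclic (singularMonomial t)) ht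
  have hNm : N ≤ homogeneousSubmodule (Fin 27) ℂ m := Finset.sup_le fun t ht =>
    cyclic_le_homogeneousSubmodule (mem_singularExponents.mp ht ▸ singularMonomial_isHomogeneous t)
  have hinv : IsRootInvariant N := by
    have h : ∀ L : List (Fin 27 × Fin 27 × ℤ),
        (∀ t, ∀ p ∈ cyclic (singularMonomial t), linDer L p ∈ cyclic (singularMonomial t)) →
        N ≤ N.comap (linDer L).toLinearMap := fun L hL =>
      Finset.sup_le fun t ht p hp => hle t ht (hL t p hp)
    exact fun i p hp => ⟨h _ (fun t p hp => (isRootInvariant_cyclic _ i p hp).1) hp,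
      h _ (fun t p hp => (isRootInvariant_cyclic _ i p hp).2) hp⟩
  refine le_antisymm hNm fun p hp => ?_
  obtain ⟨q, hq, hpq⟩ := exists_sub_mem_fischerCompl N p
  by_contra hpN
  have hne : p - q ≠ 0 := fun h => hpN (sub_eq_zero.mp h ▸ hq)
  have hinv' := (isRootInvariant_homogeneousSubmodule m).inf hinv.fischerCompl
  obtain ⟨u, ⟨hum, huN⟩, hu0, hu⟩ := exists_isSingular_of_ne_bot (fun i p hp => (hinv' i p hp).1)
    ⟨sub_mem hp (hNm hq), hpq⟩ hne
  exact hu0 (fischer_self_eq_zero (huN u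
    (hu.mem_of_isHomogeneous hum fun t ht => hle t ht (mem_cyclic _))))

lemma finrank_cyclic_singularMonomial (t : ℕ × ℕ × ℕ) :
    Module.finrank ℂ (cyclic (singularMonomial t)) = Module.finrank ℂ (Lmod t.1 t.2.1) := by
  have hC : cubicForm ≠ 0 := fun h => by
    simpa [eval_slicePoint_cubicForm] using congrArg (eval (slicePoint 1 1 1)) h
  have hinj : Function.Injective (LinearMap.mulLeft ℂ (cubicForm ^ t.2.2)) :=
    mul_right_injective₀ (pow_ne_zero _ hC)
  rw [singularMonomial, cyclic_cubicForm_pow_mul, Lmod_eq_cyclic]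
  exact (Submodule.equivMapOfInjective _ hinj _).finrank_eq.symm

lemma finrank_homogeneousSubmodule (m : ℕ) :
    Module.finrank ℂ (homogeneousSubmodule (Fin 27) ℂ m) = (m + 26).choose 26 := by
  have hset : {d : Fin 27 →₀ ℕ | d.degree = m} =
      ((Finset.univ.finsuppAntidiag m : Finset (Fin 27 →₀ ℕ)) : Set (Fin 27 →₀ ℕ)) := by
    ext d
    simp [Finset.mem_finsuppAntidiag, Finsupp.degree_eq_sum]
  rw [homogeneousSubmodule_eq_finsupp_supported, hset,
    (AddMonoidAlgebra.supportedEquivFinsupp _).finrank_eq, Module.finrank_finsupp_self]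
  simp only [Finset.coe_sort_coe, Fintype.card_coe]
  rw [Finset.card_finsuppAntidiag_nat_eq_choose, Finset.card_univ, Fintype.card_fin,
    ← Nat.choose_symm (by omega)]
  congr 1 <;> omega

/-- the dimension identity: `C(m+26, 26)` is the sum of the
dimensions of the `L(m₁, m₂)` over triples with `m₁ + 2m₂ + 3m₃ = m`. -/
theorem stmt18 :
    (∀ m1 m2 : ℕ, Module.Finite ℂ (Lmod m1 m2)) ∧
    ∀ m : ℕ, Nat.choose (m + 26) 26 =
      ∑ t ∈ (Finset.range (m + 1) ×ˢ Finset.range (m + 1) ×ˢ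
          Finset.range (m + 1)).filter
          (fun t => t.1 + 2 * t.2.1 + 3 * t.2.2 = m),
        Module.finrank ℂ (Lmod t.1 t.2.1) := by
  refine ⟨fun m n => ?_, fun m => ?_⟩
  · rw [Lmod_eq_cyclic]
    exact Submodule.finiteDimensional_of_le
      (cyclic_le_homogeneousSubmodule (X_pow_mul_zeta_one_pow_isHomogeneous m n))
  · rw [← finrank_homogeneousSubmodule, ← sup_cyclic_singularMonomial,
      finrank_sup_of_fischer_orthogonal _ _ fun s hs t ht =>
        cyclic_singularMonomial_le_fischerCompl hs ht]
    exact Finset.sum_congr rfl fun t _ => finrank_cyclic_singularMonomial t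

end
end
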